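/- arXiv:2210.17024 — 2 statements merged into one kernel-verified Lean document; each statement's English description precedes it below -/
import Mathlib

section
/- Let E be a real Banach space and let M be a nonempty bounded convex open subset of E. Let F be a map defined on the closure of M, mapping the closure of M into itself, which is continuous, whose image F(cl M) has compact closure, and which is Fréchet differentiable at every point of M. Assume: (i) for each m ∈ M, 1 is not an eigenvalue of the Fréchet derivative F'(m), i.e. for every v ≠ 0 one has F'(m)v ≠ v; and (ii) for each m in the boundary of M, F(m) ≠ m. Then F has a unique fixed point, and this fixed point lies in M. -/
open Set Filter Topology MeasureTheory

section FiniteDimensional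

variable {V : Type*} [NormedAddCommGroup V] [NormedSpace ℝ V] [FiniteDimensional ℝ V]

/-- Lagrange interpolation of `s ↦ det (s + A)` at nodes beyond a prescribed bound. -/
theorem exists_det_eq_sum_det_smul_id_add (V : Type*) [NormedAddCommGroup V] [NormedSpace ℝ V]
    [FiniteDimensional ℝ V] (R : ℝ) :
    ∃ (t : Finset ℝ) (w : ℝ → ℝ), (∀ s ∈ t, R < s) ∧ ∀ A : V →L[ℝ] V,
      A.det = ∑ s ∈ t, w s * (s • ContinuousLinearMap.id ℝ V + A).det := by
  classical
  obtain ⟨t, htR, htc⟩ := (Set.Ioi_infinite R).exists_subset_card_eq (Module.finrank ℝ V + 1)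
  refine ⟨t, fun s ↦ (Lagrange.basis t id s).eval 0, fun s hs ↦ htR hs, fun A ↦ ?_⟩
  set p := (-(A : V →ₗ[ℝ] V)).charpoly with hp
  have hdeg : p.degree < t.card := by
    rw [htc, Polynomial.degree_eq_natDegree (LinearMap.charpoly_monic _).ne_zero,
      LinearMap.charpoly_natDegree]
    exact_mod_cast Nat.lt_succ_self _
  have heval : ∀ s : ℝ, p.eval s = (s • ContinuousLinearMap.id ℝ V + A).det := by
    intro s
    rw [hp, LinearMap.eval_charpoly, ContinuousLinearMap.det]
    congr 1
    ext v
    simp [Algebra.algebraMap_eq_smul_one]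
  have h0 := heval 0
  rw [zero_smul, zero_add] at h0
  rw [← h0]
  conv_lhs => rw [Lagrange.eq_interpolate (f := p) (v := id) (s := t) (injOn_id _) hdeg]
  rw [Lagrange.interpolate_apply, Polynomial.eval_finsetSum]
  refine Finset.sum_congr rfl fun s _ ↦ ?_
  simp [heval, mul_comm]

theorem det_smul_id_add_pos {A : V →L[ℝ] V} {s : ℝ} (h : ‖A‖ < s) :
    0 < (s • ContinuousLinearMap.id ℝ V + A).det := by
  have hs : 0 < s := (norm_nonneg A).trans_lt h
  set q : ℝ → ℝ := fun t ↦ (s • ContinuousLinearMap.id ℝ V + t • A).det with hq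
  have hqc : Continuous q := ContinuousLinearMap.continuous_det.comp (by fun_prop)
  have hne : ∀ t ∈ Icc (0 : ℝ) 1, q t ≠ 0 := by
    intro t ht h0
    obtain ⟨v, hv, hv0⟩ := Submodule.exists_mem_ne_zero_of_ne_bot
      (LinearMap.bot_lt_ker_of_det_eq_zero (f := ((s • ContinuousLinearMap.id ℝ V + t • A :
        V →L[ℝ] V) : V →ₗ[ℝ] V)) h0).ne'
    have h1 : s • v = -(t • A v) := by
      rw [eq_neg_iff_add_eq_zero]; simpa using hv
    have h2 := congrArg norm h1
    rw [norm_neg, norm_smul, norm_smul, Real.norm_of_nonneg hs.le, Real.norm_of_nonneg ht.1] at h2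
    have h3 : t * ‖A v‖ ≤ 1 * (‖A‖ * ‖v‖) :=
      mul_le_mul ht.2 (A.le_opNorm v) (norm_nonneg _) zero_le_one
    have h4 : 0 < ‖v‖ := norm_pos_iff.mpr hv0
    nlinarith
  have hq0 : 0 < q 0 := by
    simp only [hq, zero_smul, add_zero]
    have : (s • ContinuousLinearMap.id ℝ V).det = s ^ Module.finrank ℝ V := by
      simp [ContinuousLinearMap.det]
    rw [this]; positivity
  by_contra hcon
  have hq1 : q 1 ≤ 0 := by simpa [hq] using hcon
  obtain ⟨t, ht, ht0⟩ := intermediate_value_Icc' zero_le_one hqc.continuousOn ⟨hq1, hq0.le⟩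
  exact hne t ht ht0

theorem bijective_smul_add_of_lipschitz {f : V → V} {C : NNReal} (hf : LipschitzWith C f) {s : ℝ}
    (hs : (C : ℝ) < s) : Function.Bijective fun x ↦ s • x + f x := by
  have hs0 : 0 < s := C.2.trans_lt hs
  have hc : ∀ y, ContractingWith (C / s.toNNReal) fun x ↦ s⁻¹ • (y - f x) := by
    intro y
    have hs' : 0 < s.toNNReal := Real.toNNReal_pos.mpr hs0
    refine ⟨?_, LipschitzWith.of_dist_le_mul fun a b ↦ ?_⟩
    · rw [div_lt_one hs', ← NNReal.coe_lt_coe, Real.coe_toNNReal _ hs0.le]; exact hs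
    · rw [dist_eq_norm, ← smul_sub, norm_smul, sub_sub_sub_cancel_left, NNReal.coe_div,
        Real.coe_toNNReal _ hs0.le, norm_inv, Real.norm_of_nonneg hs0.le, div_mul_eq_mul_div,
        inv_mul_le_iff₀ hs0, mul_div_cancel₀ _ hs0.ne', ← dist_eq_norm, dist_comm]
      exact hf.dist_le_mul a b
  have key : ∀ x y, s • x + f x = y ↔ Function.IsFixedPt (fun x ↦ s⁻¹ • (y - f x)) x := by
    intro x y
    rw [Function.IsFixedPt, inv_smul_eq_iff₀ hs0.ne', sub_eq_iff_eq_add, eq_comm]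
  refine ⟨fun a b hab ↦ ?_, fun y ↦ ?_⟩
  · exact (hc _).fixedPoint_unique' ((key a _).mp hab) ((key b _).mp rfl)
  · exact ⟨(hc y).fixedPoint, (key _ _).mpr (hc y).fixedPoint_isFixedPt⟩

theorem exists_contDiff_eventuallyEq_one {K U : Set V} (hK : IsCompact K) (hU : IsOpen U)
    (hKU : K ⊆ U) : ∃ (χ : V → ℝ) (L : Set V), ContDiff ℝ 1 χ ∧ (∀ x, χ x ∈ Icc (0 : ℝ) 1) ∧
      (∀ x ∈ K, χ =ᶠ[𝓝 x] 1) ∧ IsCompact L ∧ L ⊆ U ∧ ∀ x ∉ L, χ x = 0 := by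
  obtain ⟨L, hL, hKL, hLU⟩ := exists_compact_between hK hU hKU
  obtain ⟨χ, h1, h0, hI⟩ := exists_contMDiffMap_one_nhds_of_subset_interior (n := 1)
    (modelWithCornersSelf ℝ V) hK.isClosed hKL
  refine ⟨χ, L, χ.contMDiff.contDiff, hI, fun x hx ↦ ?_, hL, hLU, h0⟩
  exact h1.filter_mono (nhds_le_nhdsSet hx)

variable [MeasurableSpace V] [BorelSpace V] (μ : Measure V) [μ.IsAddHaarMeasure]

theorem integral_det_smul_id_add {f : V → V} {C : NNReal} (hf : LipschitzWith C f)
    (hd : Differentiable ℝ f) {s : ℝ} (hs : (C : ℝ) < s) {K : Set V} (hK : MeasurableSet K) :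
    ∫ x in K, (s • ContinuousLinearMap.id ℝ V + fderiv ℝ f x).det ∂μ
      = μ.real ((fun x ↦ s • x + f x) '' K) := by
  have h1 := integral_image_eq_integral_abs_det_fderiv_smul μ hK
    (f := fun x ↦ s • x + f x) (f' := fun x ↦ s • ContinuousLinearMap.id ℝ V + fderiv ℝ f x)
    (fun x _ ↦ (((hasFDerivAt_id x).const_smul s).add (hd x).hasFDerivAt).hasFDerivWithinAt)
    (bijective_smul_add_of_lipschitz hf hs).injective.injOn (fun _ ↦ (1 : ℝ))
  rw [setIntegral_const, smul_eq_mul, mul_one] at h1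
  rw [h1]
  refine setIntegral_congr_fun hK fun x _ ↦ ?_
  have hn : ‖fderiv ℝ f x‖ < s := (norm_fderiv_le_of_lipschitz ℝ hf).trans_lt hs
  simp [abs_of_pos (det_smul_id_add_pos hn)]

theorem setIntegral_det_fderiv_eq_of_hasCompactSupport {f g : V → V} (hf : ContDiff ℝ 1 f)
    (hg : ContDiff ℝ 1 g) (hfc : HasCompactSupport f) (hgc : HasCompactSupport g) {K : Set V}
    (hK : IsCompact K) (hfg : ∀ x ∉ K, f x = g x) :
    ∫ x in K, (fderiv ℝ f x).det ∂μ = ∫ x in K, (fderiv ℝ g x).det ∂μ := by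
  obtain ⟨C, hC⟩ := ContDiff.lipschitzWith_of_hasCompactSupport hfc hf one_ne_zero
  obtain ⟨D, hD⟩ := ContDiff.lipschitzWith_of_hasCompactSupport hgc hg one_ne_zero
  obtain ⟨t, w, ht, hw⟩ := exists_det_eq_sum_det_smul_id_add V (max C D)
  have hintegrable : ∀ {h : V → V}, ContDiff ℝ 1 h → ∀ s ∈ t, Integrable
      (fun x ↦ w s * (s • ContinuousLinearMap.id ℝ V + fderiv ℝ h x).det) (μ.restrict K) := by
    intro h hh s _
    have hcont : Continuous fun x ↦ w s * (s • ContinuousLinearMap.id ℝ V + fderiv ℝ h x).det :=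
      continuous_const.mul (ContinuousLinearMap.continuous_det.comp
        (continuous_const.add (hh.continuous_fderiv one_ne_zero)))
    exact hcont.continuousOn.integrableOn_compact hK
  rw [show (fun x ↦ (fderiv ℝ f x).det) = _ from funext fun x ↦ hw (fderiv ℝ f x),
    show (fun x ↦ (fderiv ℝ g x).det) = _ from funext fun x ↦ hw (fderiv ℝ g x)]
  rw [integral_finsetSum _ (hintegrable hf), integral_finsetSum _ (hintegrable hg)]
  refine Finset.sum_congr rfl fun s hs ↦ ?_
  have hCs : (C : ℝ) < s := (le_max_left _ _).trans_lt (ht s hs)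
  have hDs : (D : ℝ) < s := (le_max_right _ _).trans_lt (ht s hs)
  rw [integral_const_mul, integral_const_mul,
    integral_det_smul_id_add μ hC (hf.differentiable one_ne_zero) hCs hK.measurableSet,
    integral_det_smul_id_add μ hD (hg.differentiable one_ne_zero) hDs hK.measurableSet]
  have hbf := bijective_smul_add_of_lipschitz hC hCs
  have hbg := bijective_smul_add_of_lipschitz hD hDs
  have himg : (fun x ↦ s • x + f x) '' K = (fun x ↦ s • x + g x) '' K := by
    rw [← compl_inj_iff, ← image_compl_eq hbf, ← image_compl_eq hbg]
    exact image_congr fun x hx ↦ by rw [hfg x hx]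
  rw [himg]

/-- The integral of the Jacobian determinant only depends on the values near the boundary. -/
theorem setIntegral_det_fderiv_eq {f g : V → V} (hf : ContDiff ℝ 1 f) (hg : ContDiff ℝ 1 g)
    {K : Set V} (hK : IsCompact K) (hfg : ∀ x ∉ K, f x = g x) :
    ∫ x in K, (fderiv ℝ f x).det ∂μ = ∫ x in K, (fderiv ℝ g x).det ∂μ := by
  obtain ⟨χ, L, hχ, -, h1, hL, -, h0⟩ := exists_contDiff_eventuallyEq_one hK isOpen_univ
    (subset_univ K)
  have hcut : ∀ {h : V → V}, ContDiff ℝ 1 h →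
      ∫ x in K, (fderiv ℝ h x).det ∂μ = ∫ x in K, (fderiv ℝ (fun x ↦ χ x • h x) x).det ∂μ := by
    intro h _
    refine setIntegral_congr_fun hK.measurableSet fun x hx ↦ ?_
    have : (fun x ↦ χ x • h x) =ᶠ[𝓝 x] h := by
      filter_upwards [h1 x hx] with y hy
      simp [hy]
    simp only [this.fderiv_eq]
  have hsupp : ∀ h : V → V, HasCompactSupport fun x ↦ χ x • h x := fun h ↦
    HasCompactSupport.intro hL fun x hx ↦ by simp [h0 x hx]
  rw [hcut hf, hcut hg]
  exact setIntegral_det_fderiv_eq_of_hasCompactSupport μ (hχ.smul hf) (hχ.smul hg) (hsupp f)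
    (hsupp g) hK fun x hx ↦ by simp [hfg x hx]

end FiniteDimensional

section Degree

variable {V : Type*} [NormedAddCommGroup V] [NormedSpace ℝ V] [FiniteDimensional ℝ V]

theorem det_pi_smul_proj {n : ℕ} (a : Fin n → ℝ) :
    (ContinuousLinearMap.pi fun i ↦ a i • ContinuousLinearMap.proj (R := ℝ)
      (φ := fun _ : Fin n ↦ ℝ) i).det = ∏ i, a i := by
  rw [← Matrix.det_diagonal, ContinuousLinearMap.det, ← LinearMap.det_toLin']
  congr 1
  ext i j
  simp [Matrix.mulVec_diagonal, Pi.single_apply]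

/-- There is a `C¹` self-map whose Jacobian determinant is a bump near the origin. -/
theorem exists_contDiff_det_fderiv_bump (V : Type*) [NormedAddCommGroup V] [NormedSpace ℝ V]
    [FiniteDimensional ℝ V] : ∃ Ψ : V → V, ContDiff ℝ 1 Ψ ∧
      (∀ y, 1 / 2 ≤ ‖y‖ → (fderiv ℝ Ψ y).det = 0) ∧ (∀ y, 0 ≤ (fderiv ℝ Ψ y).det) ∧
      (fderiv ℝ Ψ 0).det ≠ 0 := by
  obtain ⟨n, e⟩ : ∃ n, Nonempty (V ≃L[ℝ] (Fin n → ℝ)) :=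
    ⟨Module.finrank ℝ V, ⟨ContinuousLinearEquiv.ofFinrankEq (by simp)⟩⟩
  obtain ⟨e⟩ := e
  set C : ℝ := ‖(e.symm : (Fin n → ℝ) →L[ℝ] V)‖ + 1 with hC
  have hC0 : 0 < C := by positivity
  let b : ContDiffBump (0 : ℝ) := ⟨1 / (4 * C), 1 / (2 * C), by positivity, by
    apply one_div_lt_one_div_of_lt <;> linarith⟩
  let B : ℝ → ℝ := fun s ↦ ∫ u in (0 : ℝ)..s, b u
  have hB : ∀ s, HasDerivAt B (b s) s := fun s ↦
    (b.continuous).integral_hasStrictDerivAt 0 s |>.hasDerivAt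
  have hBc : ContDiff ℝ 1 B := by
    rw [contDiff_one_iff_deriv]
    refine ⟨fun s ↦ (hB s).differentiableAt, ?_⟩
    rw [show deriv B = b from funext fun s ↦ (hB s).deriv]
    exact b.continuous
  let Q : (Fin n → ℝ) → Fin n → ℝ := fun z i ↦ B (z i)
  have hQ : ∀ z, HasFDerivAt Q (ContinuousLinearMap.pi fun i ↦ b (z i) •
      ContinuousLinearMap.proj (R := ℝ) (φ := fun _ : Fin n ↦ ℝ) i) z := by
    intro z
    rw [hasFDerivAt_pi]
    intro i
    exact (hB (z i)).comp_hasFDerivAt z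
      (ContinuousLinearMap.proj (R := ℝ) (φ := fun _ : Fin n ↦ ℝ) i).hasFDerivAt
  have hQc : ContDiff ℝ 1 Q :=
    contDiff_pi.mpr fun i ↦ hBc.comp (contDiff_apply ℝ ℝ i)
  have hdet : ∀ y, (fderiv ℝ (fun x ↦ e.symm (Q (e x))) y).det = ∏ i, b (e y i) := by
    intro y
    have h := (e.symm.hasFDerivAt (x := Q (e y))).comp y ((hQ (e y)).comp y e.hasFDerivAt)
    rw [show (fun x ↦ e.symm (Q (e x))) = e.symm ∘ Q ∘ e from rfl, h.fderiv,
      ← det_pi_smul_proj]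
    exact LinearMap.det_conj _ e.symm.toLinearEquiv
  refine ⟨fun x ↦ e.symm (Q (e x)), e.symm.contDiff.comp (hQc.comp e.contDiff), ?_, ?_, ?_⟩
  · intro y hy
    rw [hdet]
    by_contra hne
    have hlt : ∀ i, ‖e y i‖ < 1 / (2 * C) := by
      intro i
      have h1 : b (e y i) ≠ 0 := fun h ↦ hne (Finset.prod_eq_zero (Finset.mem_univ i) h)
      have h2 : e y i ∈ Function.support b := h1
      rw [b.support_eq] at h2
      rwa [mem_ball_zero_iff] at h2
    have h1 : ‖e y‖ < 1 / (2 * C) := (pi_norm_lt_iff (by positivity)).mpr hlt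
    have h2 : ‖y‖ ≤ ‖(e.symm : (Fin n → ℝ) →L[ℝ] V)‖ * ‖e y‖ := by
      simpa using (e.symm : (Fin n → ℝ) →L[ℝ] V).le_opNorm (e y)
    have h3 : ‖(e.symm : (Fin n → ℝ) →L[ℝ] V)‖ * ‖e y‖ ≤ C * ‖e y‖ := by
      gcongr; linarith
    have h4 : C * ‖e y‖ < C * (1 / (2 * C)) := by gcongr
    have h5 : C * (1 / (2 * C)) = 1 / 2 := by field_simp
    linarith
  · intro y
    rw [hdet]
    exact Finset.prod_nonneg fun i _ ↦ b.nonneg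
  · rw [hdet, Finset.prod_ne_zero_iff]
    intro i _
    rw [map_zero, Pi.zero_apply, b.one_of_mem_closedBall (Metric.mem_closedBall_self b.rIn_pos.le)]
    exact one_ne_zero

/-- A `C¹` map whose Jacobian determinant is a bump near the origin. -/
noncomputable def bumpMap (V : Type*) [NormedAddCommGroup V] [NormedSpace ℝ V]
    [FiniteDimensional ℝ V] : V → V :=
  (exists_contDiff_det_fderiv_bump V).choose

/-- The Jacobian determinant of `bumpMap`. -/
noncomputable def bumpDensity (y : V) : ℝ := (fderiv ℝ (bumpMap V) y).det

theorem contDiff_bumpMap : ContDiff ℝ 1 (bumpMap V) :=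
  (exists_contDiff_det_fderiv_bump V).choose_spec.1

theorem bumpDensity_eq_zero {y : V} (h : 1 / 2 ≤ ‖y‖) : bumpDensity y = 0 :=
  (exists_contDiff_det_fderiv_bump V).choose_spec.2.1 y h

theorem bumpDensity_nonneg (y : V) : 0 ≤ bumpDensity y :=
  (exists_contDiff_det_fderiv_bump V).choose_spec.2.2.1 y

theorem bumpDensity_zero_ne_zero : bumpDensity (0 : V) ≠ 0 :=
  (exists_contDiff_det_fderiv_bump V).choose_spec.2.2.2

theorem continuous_bumpDensity : Continuous (bumpDensity : V → ℝ) :=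
  ContinuousLinearMap.continuous_det.comp (contDiff_bumpMap.continuous_fderiv one_ne_zero)

theorem det_fderiv_bumpMap_comp {g : V → V} {x : V} (hg : DifferentiableAt ℝ g x) :
    (fderiv ℝ (fun x ↦ bumpMap V (g x)) x).det = bumpDensity (g x) * (fderiv ℝ g x).det := by
  rw [show (fun x ↦ bumpMap V (g x)) = bumpMap V ∘ g from rfl,
    fderiv_comp x (contDiff_bumpMap.differentiable one_ne_zero _) hg]
  exact LinearMap.det_comp _ _

theorem continuous_bumpDensity_mul_det {g : V → V} (hg : ContDiff ℝ 1 g) :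
    Continuous fun x ↦ bumpDensity (g x) * (fderiv ℝ g x).det :=
  (continuous_bumpDensity.comp hg.continuous).mul
    (ContinuousLinearMap.continuous_det.comp (hg.continuous_fderiv one_ne_zero))

variable [MeasurableSpace V] [BorelSpace V] (μ : Measure V) [μ.IsAddHaarMeasure]

theorem integral_bumpDensity_pos : 0 < ∫ y : V, bumpDensity y ∂μ := by
  refine continuous_bumpDensity.integral_pos_of_hasCompactSupport_nonneg_nonzero ?_
    bumpDensity_nonneg bumpDensity_zero_ne_zero
  refine HasCompactSupport.intro (isCompact_closedBall (0 : V) (1 / 2)) fun x hx ↦ ?_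
  exact bumpDensity_eq_zero (by simpa using (not_le.mp (mt mem_closedBall_zero_iff.mpr hx)).le)

/-- The degree at `0` of a `C¹` map, in integral form. -/
noncomputable def jacobianDegree (g : V → V) (U : Set V) : ℝ :=
  (∫ y : V, bumpDensity y ∂μ)⁻¹ * ∫ x in U, bumpDensity (g x) * (fderiv ℝ g x).det ∂μ

theorem integrableOn_bumpDensity_mul_det {g : V → V} (hg : ContDiff ℝ 1 g) {U : Set V}
    (hU : Bornology.IsBounded U) :
    IntegrableOn (fun x ↦ bumpDensity (g x) * (fderiv ℝ g x).det) U μ :=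
  ((continuous_bumpDensity_mul_det hg).continuousOn.integrableOn_compact
    hU.isCompact_closure).mono_set subset_closure

theorem jacobianDegree_eq_of_homotopy {g₀ g₁ : V → V} (h₀ : ContDiff ℝ 1 g₀) (h₁ : ContDiff ℝ 1 g₁)
    {U : Set V} (hU : IsOpen U) (hb : Bornology.IsBounded U)
    (h : ∀ x ∈ frontier U, ∀ t ∈ Icc (0 : ℝ) 1, 1 ≤ ‖(1 - t) • g₀ x + t • g₁ x‖) :
    jacobianDegree μ g₀ U = jacobianDegree μ g₁ U := by
  set W : Set V := Prod.fst '' {p : V × ℝ | p ∈ closure U ×ˢ Icc (0 : ℝ) 1 ∧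
    ‖(1 - p.2) • g₀ p.1 + p.2 • g₁ p.1‖ ≤ 1 / 2} with hW
  have hWc : IsCompact W := by
    refine IsCompact.image ?_ continuous_fst
    refine (hb.isCompact_closure.prod isCompact_Icc).inter_right
      (t := {p : V × ℝ | ‖(1 - p.2) • g₀ p.1 + p.2 • g₁ p.1‖ ≤ 1 / 2}) ?_
    have := h₀.continuous
    have := h₁.continuous
    exact isClosed_le (by fun_prop) continuous_const
  have hWU : W ⊆ U := by
    rintro x ⟨⟨x, t⟩, ⟨⟨hx, ht⟩, hle⟩, rfl⟩
    by_contra hxU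
    have := h x ⟨hx, by rwa [hU.interior_eq]⟩ t ht
    simp only at hle
    linarith
  obtain ⟨χ, L, hχ, hχI, hχ1, hL, hLU, hχ0⟩ := exists_contDiff_eventuallyEq_one hWc hU hWU
  set g : V → V := fun x ↦ (1 - χ x) • g₀ x + χ x • g₁ x with hg
  have hgc : ContDiff ℝ 1 g := ((contDiff_const.sub hχ).smul h₀).add (hχ.smul h₁)
  have hnW : ∀ x ∈ U, x ∉ W → ∀ t ∈ Icc (0 : ℝ) 1,
      bumpDensity ((1 - t) • g₀ x + t • g₁ x) = 0 := by
    intro x hx hxW t ht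
    refine bumpDensity_eq_zero (le_of_not_ge fun hle ↦ hxW ?_)
    exact ⟨(x, t), ⟨⟨subset_closure hx, ht⟩, hle⟩, rfl⟩
  have key₁ : ∫ x in U, bumpDensity (g x) * (fderiv ℝ g x).det ∂μ
      = ∫ x in U, bumpDensity (g₁ x) * (fderiv ℝ g₁ x).det ∂μ := by
    refine setIntegral_congr_fun hU.measurableSet fun x hx ↦ ?_
    by_cases hxW : x ∈ W
    · have : g =ᶠ[𝓝 x] g₁ := by
        filter_upwards [hχ1 x hxW] with y hy
        simp [hg, hy]
      simp only [this.eq_of_nhds, this.fderiv_eq]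
    · have e1 : bumpDensity (g x) = 0 := hnW x hx hxW _ (hχI x)
      have e2 : bumpDensity (g₁ x) = 0 := by
        simpa using hnW x hx hxW 1 (right_mem_Icc.mpr zero_le_one)
      simp only [e1, e2, zero_mul]
  have hoff : ∀ x ∉ L, g x = g₀ x := fun x hx ↦ by simp [hg, hχ0 x hx]
  have key₂ : ∫ x in L, bumpDensity (g x) * (fderiv ℝ g x).det ∂μ
      = ∫ x in L, bumpDensity (g₀ x) * (fderiv ℝ g₀ x).det ∂μ := by
    have := setIntegral_det_fderiv_eq μ (contDiff_bumpMap.comp hgc) (contDiff_bumpMap.comp h₀) hL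
      (fun x hx ↦ by simp [hoff x hx])
    simpa only [Function.comp_def, det_fderiv_bumpMap_comp (hgc.differentiable one_ne_zero _),
      det_fderiv_bumpMap_comp (h₀.differentiable one_ne_zero _)] using this
  have key₃ : ∫ x in U \ L, bumpDensity (g x) * (fderiv ℝ g x).det ∂μ
      = ∫ x in U \ L, bumpDensity (g₀ x) * (fderiv ℝ g₀ x).det ∂μ := by
    refine setIntegral_congr_fun (hU.measurableSet.diff hL.measurableSet) fun x hx ↦ ?_
    have : g =ᶠ[𝓝 x] g₀ := by
      filter_upwards [hL.isClosed.isOpen_compl.mem_nhds hx.2] with y hy using hoff y hy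
    simp only [this.eq_of_nhds, this.fderiv_eq]
  have hsplit : ∀ {k : V → V}, ContDiff ℝ 1 k →
      ∫ x in U, bumpDensity (k x) * (fderiv ℝ k x).det ∂μ
        = ∫ x in L, bumpDensity (k x) * (fderiv ℝ k x).det ∂μ
          + ∫ x in U \ L, bumpDensity (k x) * (fderiv ℝ k x).det ∂μ := by
    intro k hk
    rw [← integral_inter_add_sdiff hL.measurableSet (integrableOn_bumpDensity_mul_det μ hk hb),
      inter_eq_self_of_subset_right hLU]
  rw [jacobianDegree, jacobianDegree, ← key₁, hsplit h₀, hsplit hgc, key₂, key₃]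

theorem jacobianDegree_eq_sum {g : V → V} (hg : ContDiff ℝ 1 g) {U : Set V}
    (hU : MeasurableSet U) (hb : Bornology.IsBounded U) {ι : Type*} (s : Finset ι) (W : ι → Set V)
    (hW : ∀ i ∈ s, MeasurableSet (W i)) (hWU : ∀ i ∈ s, W i ⊆ U)
    (hd : (s : Set ι).PairwiseDisjoint W) (h : ∀ x ∈ U, (∀ i ∈ s, x ∉ W i) → 1 ≤ ‖g x‖) :
    jacobianDegree μ g U = ∑ i ∈ s, jacobianDegree μ g (W i) := by
  simp only [jacobianDegree, ← Finset.mul_sum]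
  congr 1
  rw [← integral_biUnion_finset s hW hd
    fun i hi ↦ integrableOn_bumpDensity_mul_det μ hg (hb.subset (hWU i hi))]
  refine setIntegral_eq_of_subset_of_forall_sdiff_eq_zero hU (iUnion₂_subset hWU)
    fun x hx ↦ ?_
  rw [bumpDensity_eq_zero, zero_mul]
  have := h x hx.1 fun i hi hxi ↦ hx.2 (mem_iUnion₂.mpr ⟨i, hi, hxi⟩)
  linarith

theorem jacobianDegree_linear {T : V →L[ℝ] V} (hT : T.det ≠ 0) (x₀ : V) {U : Set V}
    (hU : ∀ x, ‖T (x - x₀)‖ < 1 → x ∈ U) :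
    jacobianDegree μ (fun x ↦ T (x - x₀)) U = T.det / |T.det| := by
  have hder : ∀ x, HasFDerivAt (fun x ↦ T (x - x₀)) T x := fun x ↦
    T.hasFDerivAt.comp x ((hasFDerivAt_id x).sub_const x₀)
  have hbij : Function.Bijective fun x ↦ T (x - x₀) := by
    have hTb : Function.Bijective T :=
      ((LinearMap.equivOfDetNeZero (T : V →ₗ[ℝ] V) hT)).bijective
    exact hTb.comp (Equiv.subRight x₀).bijective
  have hcv := integral_image_eq_integral_abs_det_fderiv_smul μ MeasurableSet.univ
    (fun x _ ↦ (hder x).hasFDerivWithinAt) hbij.injective.injOn (bumpDensity : V → ℝ)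
  rw [image_univ, hbij.surjective.range_eq, setIntegral_univ, setIntegral_univ] at hcv
  simp only [smul_eq_mul] at hcv
  rw [integral_const_mul] at hcv
  have hall : ∫ x in U, bumpDensity (T (x - x₀)) ∂μ = ∫ x, bumpDensity (T (x - x₀)) ∂μ := by
    refine setIntegral_eq_integral_of_forall_compl_eq_zero fun x hx ↦ bumpDensity_eq_zero ?_
    have := le_of_not_gt (mt (hU x) hx)
    linarith
  simp only [jacobianDegree, (hder _).fderiv]
  rw [integral_mul_const, hall, hcv]
  have hpos := integral_bumpDensity_pos (V := V) μ
  rw [hcv] at hpos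
  have h1 : |T.det| ≠ 0 := abs_ne_zero.mpr hT
  have h2 : ∫ x, bumpDensity (T (x - x₀)) ∂μ ≠ 0 := by
    intro h0; rw [h0, mul_zero] at hpos; exact lt_irrefl _ hpos
  field_simp

end Degree

section SmoothDegree

variable {V : Type*} [NormedAddCommGroup V] [NormedSpace ℝ V] [FiniteDimensional ℝ V]

/-- The degree at `0` of a `C¹` map, computed with Haar measure. -/
noncomputable def smoothDegree (g : V → V) (U : Set V) : ℝ :=
  letI : MeasurableSpace V := borel V
  haveI : BorelSpace V := ⟨rfl⟩
  jacobianDegree Measure.addHaar g U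

theorem smoothDegree_eq_of_homotopy {g₀ g₁ : V → V} (h₀ : ContDiff ℝ 1 g₀) (h₁ : ContDiff ℝ 1 g₁)
    {U : Set V} (hU : IsOpen U) (hb : Bornology.IsBounded U)
    (h : ∀ x ∈ frontier U, ∀ t ∈ Icc (0 : ℝ) 1, 1 ≤ ‖(1 - t) • g₀ x + t • g₁ x‖) :
    smoothDegree g₀ U = smoothDegree g₁ U :=
  letI : MeasurableSpace V := borel V
  haveI : BorelSpace V := ⟨rfl⟩
  jacobianDegree_eq_of_homotopy _ h₀ h₁ hU hb h

theorem smoothDegree_eq_sum {g : V → V} (hg : ContDiff ℝ 1 g) {U : Set V}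
    (hU : IsOpen U) (hb : Bornology.IsBounded U) {ι : Type*} (s : Finset ι) (W : ι → Set V)
    (hW : ∀ i ∈ s, IsOpen (W i)) (hWU : ∀ i ∈ s, W i ⊆ U)
    (hd : (s : Set ι).PairwiseDisjoint W) (h : ∀ x ∈ U, (∀ i ∈ s, x ∉ W i) → 1 ≤ ‖g x‖) :
    smoothDegree g U = ∑ i ∈ s, smoothDegree g (W i) :=
  letI : MeasurableSpace V := borel V
  haveI : BorelSpace V := ⟨rfl⟩
  jacobianDegree_eq_sum _ hg hU.measurableSet hb s W (fun i hi ↦ (hW i hi).measurableSet) hWU hd h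

theorem smoothDegree_linear {T : V →L[ℝ] V} (hT : T.det ≠ 0) (x₀ : V) {U : Set V}
    (hU : ∀ x, ‖T (x - x₀)‖ < 1 → x ∈ U) :
    smoothDegree (fun x ↦ T (x - x₀)) U = T.det / |T.det| :=
  letI : MeasurableSpace V := borel V
  haveI : BorelSpace V := ⟨rfl⟩
  jacobianDegree_linear _ hT x₀ hU

end SmoothDegree

section FixedPointIndex

theorem Bornology.IsBounded.preimage_submodule {E : Type*} [NormedAddCommGroup E] [Module ℝ E]
    {U : Set E} (hU : Bornology.IsBounded U) (V : Submodule ℝ E) :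
    Bornology.IsBounded ((↑) ⁻¹' U : Set V) :=
  isometry_subtype_coe.antilipschitz.isBounded_preimage hU

variable {E : Type*} [NormedAddCommGroup E] [NormedSpace ℝ E]

/-- `F` is continuous on `S` and maps it into a compact set. -/
def IsCompactMapOn (F : E → E) (S : Set E) : Prop :=
  ContinuousOn F S ∧ ∃ K, IsCompact K ∧ MapsTo F S K

omit [NormedSpace ℝ E] in
theorem IsCompactMapOn.mono {F : E → E} {S T : Set E} (h : IsCompactMapOn F T) (hST : S ⊆ T) :
    IsCompactMapOn F S :=
  ⟨h.1.mono hST, h.2.imp fun _ hK ↦ ⟨hK.1, hK.2.mono_left hST⟩⟩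

/-- A `C¹` self-map of `V` which is close on `S`, up to scaling, to `x ↦ x - F x`. -/
def IsSmoothApprox (F : E → E) (S : Set E) (V : Submodule ℝ E) (g : V → V) : Prop :=
  ContDiff ℝ 1 g ∧ ∃ c : ℝ, 0 < c ∧ ∀ x : V, (x : E) ∈ S →
    ‖(g x : E) - c • ((x : E) - F x)‖ + 1 ≤ c * ‖(x : E) - F x‖

theorem IsSmoothApprox.mono {F : E → E} {S T : Set E} {V : Submodule ℝ E} {g : V → V}
    (h : IsSmoothApprox F T V g) (hST : S ⊆ T) : IsSmoothApprox F S V g :=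
  ⟨h.1, h.2.imp fun _ hc ↦ ⟨hc.1, fun x hx ↦ hc.2 x (hST hx)⟩⟩

theorem IsSmoothApprox.one_le_norm {F : E → E} {S : Set E} {V : Submodule ℝ E} {g : V → V}
    (h : IsSmoothApprox F S V g) {x : V} (hx : (x : E) ∈ S) : 1 ≤ ‖g x‖ := by
  obtain ⟨-, c, hc, h⟩ := h
  have h1 := h x hx
  have h2 := norm_sub_norm_le (c • ((x : E) - F x)) (g x)
  rw [norm_sub_rev, norm_smul, Real.norm_of_nonneg hc.le] at h2
  rw [Submodule.coe_norm]
  linarith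

theorem smoothDegree_eq_of_isSmoothApprox {F : E → E} {U : Set E} (hU : IsOpen U)
    (hb : Bornology.IsBounded U) {V : Submodule ℝ E} [FiniteDimensional ℝ V] {g₀ g₁ : V → V}
    (h₀ : IsSmoothApprox F (frontier U) V g₀) (h₁ : IsSmoothApprox F (frontier U) V g₁) :
    smoothDegree g₀ ((↑) ⁻¹' U) = smoothDegree g₁ ((↑) ⁻¹' U) := by
  obtain ⟨hd₀, c₀, hc₀, h₀⟩ := h₀
  obtain ⟨hd₁, c₁, hc₁, h₁⟩ := h₁
  refine smoothDegree_eq_of_homotopy hd₀ hd₁ (hU.preimage continuous_subtype_val)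
    (hb.preimage_submodule _) fun x hx t ht ↦ ?_
  have hx' : (x : E) ∈ frontier U := continuous_subtype_val.frontier_preimage_subset U hx
  have e₀ := h₀ x hx'
  have e₁ := h₁ x hx'
  set f : E := (x : E) - F x
  have ht' : 0 ≤ 1 - t := sub_nonneg.mpr ht.2
  have hc : 0 ≤ (1 - t) * c₀ + t * c₁ :=
    add_nonneg (mul_nonneg ht' hc₀.le) (mul_nonneg ht.1 hc₁.le)
  have h2 := norm_sub_norm_le (((1 - t) * c₀ + t * c₁) • f)
    (((1 - t) • g₀ x + t • g₁ x : V) : E)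
  rw [norm_sub_rev, norm_smul, Real.norm_of_nonneg hc] at h2
  have h3 : (((1 - t) • g₀ x + t • g₁ x : V) : E) - ((1 - t) * c₀ + t * c₁) • f
      = (1 - t) • ((g₀ x : E) - c₀ • f) + t • ((g₁ x : E) - c₁ • f) := by
    push_cast; module
  have h4 : ‖(1 - t) • ((g₀ x : E) - c₀ • f) + t • ((g₁ x : E) - c₁ • f)‖
      ≤ (1 - t) * ‖(g₀ x : E) - c₀ • f‖ + t * ‖(g₁ x : E) - c₁ • f‖ := by
    refine (norm_add_le _ _).trans_eq ?_
    rw [norm_smul, norm_smul, Real.norm_of_nonneg ht', Real.norm_of_nonneg ht.1]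
  rw [h3] at h2
  rw [Submodule.coe_norm]
  have h5 := mul_le_mul_of_nonneg_left e₀ ht'
  have h6 := mul_le_mul_of_nonneg_left e₁ ht.1
  linarith

open Classical in
/-- The fixed point index of `F` on `U`, computed in the span of the finite set `s`. -/
noncomputable def finiteIndex (s : Finset E) (F : E → E) (U : Set E) : ℝ :=
  if h : ∃ g, IsSmoothApprox F (frontier U) (Submodule.span ℝ (s : Set E)) g then
    smoothDegree h.choose ((↑) ⁻¹' U) else 0

theorem finiteIndex_eq {F : E → E} {U : Set E} (hU : IsOpen U) (hb : Bornology.IsBounded U)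
    {s : Finset E} {g : Submodule.span ℝ (s : Set E) → Submodule.span ℝ (s : Set E)}
    (hg : IsSmoothApprox F (frontier U) (Submodule.span ℝ (s : Set E)) g) :
    finiteIndex s F U = smoothDegree g ((↑) ⁻¹' U) := by
  have h : ∃ g, IsSmoothApprox F (frontier U) (Submodule.span ℝ (s : Set E)) g := ⟨g, hg⟩
  rw [finiteIndex, dif_pos h]
  exact smoothDegree_eq_of_isSmoothApprox hU hb h.choose_spec hg

theorem IsCompactMapOn.eventually_exists_approx {F : E → E} {S : Set E} (hS : IsClosed S)
    (hF : IsCompactMapOn F S) {ε : ℝ} (hε : 0 < ε) :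
    ∀ᶠ s : Finset E in atTop, ∃ G : Submodule.span ℝ (s : Set E) → Submodule.span ℝ (s : Set E),
      ContDiff ℝ 1 G ∧ ∀ x : Submodule.span ℝ (s : Set E), (x : E) ∈ S → ‖(G x : E) - F x‖ < ε := by
  obtain ⟨hFc, K, hK, hFK⟩ := hF
  obtain ⟨t, -, htf, htK⟩ := hK.finite_cover_balls hε
  filter_upwards [eventually_ge_atTop htf.toFinset] with s hs
  set V := Submodule.span ℝ (s : Set E)
  have hconv (x : V) : Convex ℝ {v : V | (x : E) ∈ S → ‖(v : E) - F x‖ < ε} := by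
    by_cases hx : (x : E) ∈ S
    · have : {v : V | (x : E) ∈ S → ‖(v : E) - F x‖ < ε}
          = V.subtype ⁻¹' Metric.ball (F x) ε := by
        ext v; simp [hx, dist_eq_norm]
      rw [this]
      exact (convex_ball _ _).linear_preimage _
    · simp [hx, convex_univ]
  have hloc (x : V) : ∃ v : V, ∀ᶠ z : V in 𝓝 x, (z : E) ∈ S → ‖(v : E) - F z‖ < ε := by
    by_cases hx : (x : E) ∈ S
    · obtain ⟨y, hy, hxy⟩ := mem_iUnion₂.mp (htK (hFK hx))
      refine ⟨⟨y, Submodule.subset_span (hs (htf.mem_toFinset.mpr hy))⟩, ?_⟩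
      have h1 : ∀ᶠ z in 𝓝[S] (x : E), F z ∈ Metric.ball y ε :=
        (hFc x hx).eventually (Metric.isOpen_ball.mem_nhds hxy)
      have h2 := continuous_subtype_val.continuousAt.eventually
        (eventually_nhdsWithin_iff.mp h1)
      filter_upwards [h2] with z hz hzS
      have := hz hzS
      rwa [Metric.mem_ball, dist_comm, dist_eq_norm] at this
    · refine ⟨0, ?_⟩
      filter_upwards [continuous_subtype_val.continuousAt.eventually
        (hS.isOpen_compl.mem_nhds hx)] with z hz hzS
      exact absurd hzS hz
  obtain ⟨G, hG⟩ := exists_contMDiffMap_forall_mem_convex_of_local_const (n := 1)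
    (modelWithCornersSelf ℝ V) hconv hloc
  exact ⟨G, G.contMDiff.contDiff, fun x hx ↦ hG x hx⟩

theorem exists_pos_le_norm_sub_homotopy {F₀ F₁ : E → E} {S : Set E} (hS : IsClosed S)
    (h₀ : IsCompactMapOn F₀ S) (h₁ : IsCompactMapOn F₁ S)
    (h : ∀ x ∈ S, ∀ t ∈ Icc (0 : ℝ) 1, x ≠ (1 - t) • F₀ x + t • F₁ x) :
    ∃ η > 0, ∀ x ∈ S, ∀ t ∈ Icc (0 : ℝ) 1, η ≤ ‖x - ((1 - t) • F₀ x + t • F₁ x)‖ := by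
  obtain ⟨hc₀, K₀, hK₀, hm₀⟩ := h₀
  obtain ⟨hc₁, K₁, hK₁, hm₁⟩ := h₁
  by_contra! hcon
  choose x hx t ht hlt using fun n : ℕ ↦ hcon (1 / (n + 1 : ℝ)) (by positivity)
  obtain ⟨⟨a, b, τ⟩, ⟨-, -, hτ⟩, φ, hφ, hlim⟩ := (hK₀.prod (hK₁.prod isCompact_Icc)).tendsto_subseq
    (x := fun n ↦ (F₀ (x n), F₁ (x n), t n)) fun n ↦ ⟨hm₀ (hx n), hm₁ (hx n), ht n⟩
  have ha : Tendsto (fun n ↦ F₀ (x (φ n))) atTop (𝓝 a) := (continuous_fst.tendsto _).comp hlim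
  have hb : Tendsto (fun n ↦ F₁ (x (φ n))) atTop (𝓝 b) :=
    (continuous_snd.fst.tendsto _).comp hlim
  have hτ' : Tendsto (fun n ↦ t (φ n)) atTop (𝓝 τ) := (continuous_snd.snd.tendsto _).comp hlim
  have hz : Tendsto (fun n ↦ x n - ((1 - t n) • F₀ (x n) + t n • F₁ (x n))) atTop (𝓝 0) :=
    squeeze_zero_norm (fun n ↦ (hlt n).le) tendsto_one_div_add_atTop_nhds_zero_nat
  have hxl : Tendsto (fun n ↦ x (φ n)) atTop (𝓝 ((1 - τ) • a + τ • b)) := by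
    have := (hz.comp hφ.tendsto_atTop).add (((hτ'.const_sub 1).smul ha).add (hτ'.smul hb))
    simpa [Function.comp_def] using this
  set y := (1 - τ) • a + τ • b with hy
  have hyS : y ∈ S := hS.mem_of_tendsto hxl (Eventually.of_forall fun n ↦ hx _)
  have hxw : Tendsto (fun n ↦ x (φ n)) atTop (𝓝[S] y) :=
    tendsto_nhdsWithin_iff.mpr ⟨hxl, Eventually.of_forall fun n ↦ hx _⟩
  have e₀ : F₀ y = a := tendsto_nhds_unique ((hc₀ y hyS).tendsto.comp hxw) ha
  have e₁ : F₁ y = b := tendsto_nhds_unique ((hc₁ y hyS).tendsto.comp hxw) hb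
  exact h y hyS τ hτ (by rw [e₀, e₁])

theorem exists_pos_le_norm_sub {F : E → E} {S : Set E} (hS : IsClosed S)
    (hF : IsCompactMapOn F S) (h : ∀ x ∈ S, F x ≠ x) : ∃ η > 0, ∀ x ∈ S, η ≤ ‖x - F x‖ := by
  obtain ⟨η, hη, hle⟩ := exists_pos_le_norm_sub_homotopy hS hF hF fun x hx t _ ↦ by
    rw [← add_smul, sub_add_cancel, one_smul]; exact (h x hx).symm
  exact ⟨η, hη, fun x hx ↦ by simpa using hle x hx 0 (left_mem_Icc.mpr zero_le_one)⟩

theorem contDiff_smul_id_sub {V : Submodule ℝ E} {G : V → V} (hG : ContDiff ℝ 1 G) (c : ℝ) :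
    ContDiff ℝ 1 fun x ↦ c • (x - G x) :=
  (contDiff_id.sub hG).const_smul c

theorem isSmoothApprox_of_norm_sub_lt {F : E → E} {S : Set E} {V : Submodule ℝ E} {G : V → V}
    (hG : ContDiff ℝ 1 G) {η : ℝ} (hη : 0 < η) (hle : ∀ x ∈ S, η ≤ ‖x - F x‖)
    (hGF : ∀ x : V, (x : E) ∈ S → ‖(G x : E) - F x‖ < η / 3) :
    IsSmoothApprox F S V fun x ↦ (3 / η) • (x - G x) := by
  refine ⟨contDiff_smul_id_sub hG _, 3 / η, by positivity, fun x hx ↦ ?_⟩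
  have e : (((3 / η) • (x - G x) : V) : E) - (3 / η) • ((x : E) - F x)
      = -((3 / η) • ((G x : E) - F x)) := by
    push_cast; module
  rw [e, norm_neg, norm_smul, Real.norm_of_nonneg (by positivity)]
  have h1 : 3 / η * ‖(G x : E) - F x‖ ≤ 3 / η * (η / 3) := by gcongr; exact (hGF x hx).le
  have h2 : 3 / η * η ≤ 3 / η * ‖(x : E) - F x‖ := by gcongr; exact hle x hx
  have h3 : 3 / η * (η / 3) = 1 := by field_simp
  have h4 : 3 / η * η = 3 := by field_simp
  linarith

theorem eventually_finiteIndex_eq_of_homotopy {F₀ F₁ : E → E} {U : Set E} (hU : IsOpen U)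
    (hb : Bornology.IsBounded U) (h₀ : IsCompactMapOn F₀ (frontier U))
    (h₁ : IsCompactMapOn F₁ (frontier U))
    (h : ∀ x ∈ frontier U, ∀ t ∈ Icc (0 : ℝ) 1, x ≠ (1 - t) • F₀ x + t • F₁ x) :
    ∀ᶠ s : Finset E in atTop, finiteIndex s F₀ U = finiteIndex s F₁ U := by
  obtain ⟨η, hη, hle⟩ := exists_pos_le_norm_sub_homotopy isClosed_frontier h₀ h₁ h
  filter_upwards [h₀.eventually_exists_approx isClosed_frontier (ε := η / 3) (by positivity),
    h₁.eventually_exists_approx isClosed_frontier (ε := η / 3) (by positivity)]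
    with s ⟨G₀, hG₀, hF₀⟩ ⟨G₁, hG₁, hF₁⟩
  rw [finiteIndex_eq hU hb (isSmoothApprox_of_norm_sub_lt hG₀ hη (fun x hx ↦ by
      simpa using hle x hx 0 (left_mem_Icc.mpr zero_le_one)) hF₀),
    finiteIndex_eq hU hb (isSmoothApprox_of_norm_sub_lt hG₁ hη (fun x hx ↦ by
      simpa using hle x hx 1 (right_mem_Icc.mpr zero_le_one)) hF₁)]
  refine smoothDegree_eq_of_homotopy (contDiff_smul_id_sub hG₀ _) (contDiff_smul_id_sub hG₁ _)
    (hU.preimage continuous_subtype_val) (hb.preimage_submodule _) fun x hx t ht ↦ ?_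
  have hx' : (x : E) ∈ frontier U := continuous_subtype_val.frontier_preimage_subset U hx
  have ht' : 0 ≤ 1 - t := sub_nonneg.mpr ht.2
  have e : (((1 - t) • (3 / η) • (x - G₀ x) + t • (3 / η) • (x - G₁ x) : _) : E)
      = (3 / η) • (((x : E) - ((1 - t) • F₀ x + t • F₁ x))
        - ((1 - t) • ((G₀ x : E) - F₀ x) + t • ((G₁ x : E) - F₁ x))) := by
    push_cast; module
  rw [Submodule.coe_norm, e, norm_smul, Real.norm_of_nonneg (by positivity)]
  have h1 := hle x hx' t ht
  have h2 : ‖(1 - t) • ((G₀ x : E) - F₀ x) + t • ((G₁ x : E) - F₁ x)‖ ≤ η / 3 := by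
    refine (norm_add_le _ _).trans ?_
    rw [norm_smul, norm_smul, Real.norm_of_nonneg ht', Real.norm_of_nonneg ht.1]
    have h5 := mul_le_mul_of_nonneg_left (hF₀ x hx').le ht'
    have h6 := mul_le_mul_of_nonneg_left (hF₁ x hx').le ht.1
    linarith
  have h3 := norm_sub_norm_le ((x : E) - ((1 - t) • F₀ x + t • F₁ x))
    ((1 - t) • ((G₀ x : E) - F₀ x) + t • ((G₁ x : E) - F₁ x))
  calc (1 : ℝ) = 3 / η * (η / 3) := by field_simp
    _ ≤ _ := by gcongr; linarith

theorem eventually_finiteIndex_eq_sum {F : E → E} {U : Set E} (hU : IsOpen U)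
    (hb : Bornology.IsBounded U) {ι : Type*} (t : Finset ι) (W : ι → Set E)
    (hW : ∀ i ∈ t, IsOpen (W i)) (hWU : ∀ i ∈ t, W i ⊆ U)
    (hd : (t : Set ι).PairwiseDisjoint W) (hF : IsCompactMapOn F (closure U))
    (h : ∀ x ∈ closure U, (∀ i ∈ t, x ∉ W i) → F x ≠ x) :
    ∀ᶠ s : Finset E in atTop, finiteIndex s F U = ∑ i ∈ t, finiteIndex s F (W i) := by
  set S : Set E := closure U \ ⋃ i ∈ t, W i with hSdef
  have hS : IsClosed S := isClosed_closure.sdiff (isOpen_biUnion hW)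
  have hmem : ∀ x, x ∈ S ↔ x ∈ closure U ∧ ∀ i ∈ t, x ∉ W i := by
    intro x; simp [hSdef]
  obtain ⟨η, hη, hle⟩ := exists_pos_le_norm_sub hS (hF.mono sdiff_subset) fun x hx ↦
    h x ((hmem x).mp hx).1 ((hmem x).mp hx).2
  filter_upwards [(hF.mono sdiff_subset).eventually_exists_approx hS (ε := η / 3) (by positivity)]
    with s ⟨G, hG, hGF⟩
  have hg := isSmoothApprox_of_norm_sub_lt hG hη hle hGF
  have hfU : frontier U ⊆ S := by
    intro x hx
    refine (hmem x).mpr ⟨hx.1, fun i hi hxi ↦ hx.2 ?_⟩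
    rw [hU.interior_eq]
    exact hWU i hi hxi
  have hfW : ∀ i ∈ t, frontier (W i) ⊆ S := by
    intro i hi x hx
    refine (hmem x).mpr ⟨closure_mono (hWU i hi) hx.1, fun j hj hxj ↦ ?_⟩
    by_cases hij : i = j
    · subst hij
      exact hx.2 (by rwa [(hW i hi).interior_eq])
    · exact ((hd hi hj hij).closure_left (hW j hj)).notMem_of_mem_left hx.1 hxj
  rw [finiteIndex_eq hU hb (hg.mono hfU), Finset.sum_congr rfl fun i hi ↦
    finiteIndex_eq (hW i hi) (hb.subset (hWU i hi)) (hg.mono (hfW i hi))]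
  refine smoothDegree_eq_sum hg.1 (hU.preimage continuous_subtype_val) (hb.preimage_submodule _) t
    (fun i ↦ (Subtype.val ⁻¹' W i : Set (Submodule.span ℝ (s : Set E))))
    (fun i hi ↦ (hW i hi).preimage continuous_subtype_val)
    (fun i hi ↦ preimage_mono (hWU i hi)) (fun i hi j hj hij ↦ (hd hi hj hij).preimage _)
    fun x hx hxW ↦ hg.one_le_norm ((hmem x).mpr ⟨subset_closure hx, fun i hi ↦ hxW i hi⟩)

theorem finiteIndex_linear {B : E → E} {x₀ : E} {U : Set E} (hU : IsOpen U)
    (hb : Bornology.IsBounded U) (hx₀ : x₀ ∈ U) {s : Finset E}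
    (hs : x₀ ∈ Submodule.span ℝ (s : Set E))
    (T : Submodule.span ℝ (s : Set E) →L[ℝ] Submodule.span ℝ (s : Set E))
    (hT : ∀ v, (T v : E) = v - B v) (hdet : T.det ≠ 0) :
    finiteIndex s (fun x ↦ x₀ + B (x - x₀)) U = T.det / |T.det| := by
  have hTb : Function.Injective T :=
    (LinearMap.equivOfDetNeZero
      (T : Submodule.span ℝ (s : Set E) →ₗ[ℝ] Submodule.span ℝ (s : Set E)) hdet).injective
  obtain ⟨κ, hκ, hanti⟩ := (T : Submodule.span ℝ (s : Set E) →ₗ[ℝ]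
    Submodule.span ℝ (s : Set E)).exists_antilipschitzWith
    (LinearMap.ker_eq_bot.mpr hTb)
  have hbound : ∀ v, ‖v‖ ≤ κ * ‖T v‖ := fun v ↦ by
    simpa using hanti.le_mul_dist v 0
  obtain ⟨r, hr, hrU⟩ := Metric.isOpen_iff.mp hU x₀ hx₀
  set c : ℝ := κ / r with hc
  have hc0 : 0 < c := div_pos (by exact_mod_cast hκ) hr
  have hkey : ∀ x : Submodule.span ℝ (s : Set E), (x : E) ∉ U → 1 ≤ c * ‖T (x - ⟨x₀, hs⟩)‖ := by
    intro x hx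
    have h1 : r ≤ ‖x - ⟨x₀, hs⟩‖ := by
      by_contra hlt
      refine hx (hrU ?_)
      rw [Metric.mem_ball, dist_eq_norm]
      exact not_le.mp hlt
    have h2 := h1.trans (hbound _)
    rw [hc, div_mul_eq_mul_div, le_div_iff₀ hr]
    linarith
  have hfd : (c • T).det = c ^ Module.finrank ℝ (Submodule.span ℝ (s : Set E)) * T.det := by
    simp [ContinuousLinearMap.det]
  have hpow : 0 < c ^ Module.finrank ℝ (Submodule.span ℝ (s : Set E)) := by positivity
  have happrox : IsSmoothApprox (fun x ↦ x₀ + B (x - x₀)) (frontier U)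
      (Submodule.span ℝ (s : Set E))
      fun x ↦ (c • T) (x - ⟨x₀, hs⟩) := by
    refine ⟨(c • T).contDiff.comp (contDiff_id.sub contDiff_const), c, hc0, fun x hx ↦ ?_⟩
    have e : (x : E) - (x₀ + B (x - x₀)) = T (x - ⟨x₀, hs⟩) := by
      rw [hT]; push_cast; abel
    have hxU : (x : E) ∉ U := fun h ↦ hx.2 (by rwa [hU.interior_eq])
    rw [e]
    simpa using hkey x hxU
  rw [finiteIndex_eq hU hb happrox, smoothDegree_linear (T := c • T)]
  · rw [hfd, abs_mul, abs_of_pos hpow, mul_div_mul_left _ _ hpow.ne']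
  · rw [hfd]; exact mul_ne_zero hpow.ne' hdet
  · intro x hx
    by_contra hxU
    have := hkey x hxU
    rw [smul_apply, norm_smul, Real.norm_of_nonneg hc0.le] at hx
    linarith

theorem eventually_finiteIndex_const {x₀ : E} {U : Set E} (hU : IsOpen U)
    (hb : Bornology.IsBounded U) (hx₀ : x₀ ∈ U) :
    ∀ᶠ s : Finset E in atTop, finiteIndex s (fun _ ↦ x₀) U = 1 := by
  filter_upwards [eventually_ge_atTop {x₀}] with s hs
  have h := finiteIndex_linear (B := fun _ ↦ 0) hU hb hx₀ (s := s)
    (Submodule.subset_span (hs (Finset.mem_singleton_self x₀)))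
    (ContinuousLinearMap.id ℝ _) (by simp) (by simp [ContinuousLinearMap.det])
  simpa [ContinuousLinearMap.det] using h

theorem eventually_finiteIndex_finiteRank {B : E →L[ℝ] E} {N : Submodule ℝ E}
    [FiniteDimensional ℝ N] (hBN : ∀ v, B v ∈ N) (hB : ∀ v, B v = v → v = 0)
    {x₀ : E} {U : Set E} (hU : IsOpen U) (hb : Bornology.IsBounded U) (hx₀ : x₀ ∈ U) :
    ∀ᶠ s : Finset E in atTop, finiteIndex s (fun x ↦ x₀ + B (x - x₀)) U = 1 ∨
      finiteIndex s (fun x ↦ x₀ + B (x - x₀)) U = -1 := by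
  classical
  obtain ⟨t, ht⟩ := (Module.Finite.iff_fg.mp ‹FiniteDimensional ℝ N› : N.FG)
  filter_upwards [eventually_ge_atTop (insert x₀ t)] with s hs
  set V := Submodule.span ℝ (s : Set E)
  have hNV : N ≤ V := by
    rw [← ht]
    exact Submodule.span_mono fun y hy ↦ hs (Finset.mem_insert_of_mem hy)
  let T : V →L[ℝ] V := ContinuousLinearMap.id ℝ V -
    (B.comp V.subtypeL).codRestrict V fun v ↦ hNV (hBN v)
  have hT : ∀ v, (T v : E) = v - B v := fun v ↦ by simp [T]
  have hdet : T.det ≠ 0 := by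
    intro h0
    obtain ⟨v, hv, hv0⟩ := Submodule.exists_mem_ne_zero_of_ne_bot
      (LinearMap.bot_lt_ker_of_det_eq_zero (f := (T : V →ₗ[ℝ] V)) h0).ne'
    have h1 : T v = 0 := hv
    have h2 := hT v
    rw [h1, Submodule.coe_zero] at h2
    exact hv0 (Subtype.ext (hB v (sub_eq_zero.mp h2.symm).symm))
  rw [finiteIndex_linear hU hb hx₀
    (Submodule.subset_span (hs (Finset.mem_insert_self _ _))) T hT hdet]
  rcases lt_or_gt_of_ne hdet with h | h
  · right; rw [abs_of_neg h, div_neg, div_self hdet]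
  · left; rw [abs_of_pos h, div_self hdet]

end FixedPointIndex

section CompactLinear

variable {E : Type*} [NormedAddCommGroup E] [NormedSpace ℝ E]

theorem IsCompactOperator.exists_pos_le_norm_sub {A : E →L[ℝ] E} (hA : IsCompactOperator A)
    (h : ∀ v, v ≠ 0 → A v ≠ v) : ∃ c > 0, ∀ v, c * ‖v‖ ≤ ‖v - A v‖ := by
  have h1 : ¬ Module.End.HasEigenvalue (A : Module.End ℝ E) 1 := by
    intro h1
    obtain ⟨v, hv⟩ := h1.exists_hasEigenvector
    exact h v hv.2 (by simpa using hv.apply_eq_smul)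
  obtain ⟨c, hc, hle⟩ := antilipschitzWith_iff_exists_mul_le_norm.mp
    (hA.antilipschitz_of_not_hasEigenvalue one_ne_zero h1)
  refine ⟨c, hc, fun v ↦ (hle v).trans_eq ?_⟩
  rw [norm_sub_rev]
  simp

theorem HasFDerivAt.isCompactOperator [CompleteSpace E] {F : E → E} {A : E →L[ℝ] E} {m : E}
    (h : HasFDerivAt F A m) {K S : Set E} (hK : IsCompact K) (hS : S ∈ 𝓝 m) (hFK : MapsTo F S K) :
    IsCompactOperator A := by
  have htb : TotallyBounded (A '' Metric.ball 0 1) := by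
    rw [Metric.totallyBounded_iff]
    intro ε hε
    have h1 := h.isLittleO.def (half_pos hε)
    obtain ⟨δ, hδ, hball⟩ := Metric.eventually_nhds_iff_ball.mp (h1.and hS)
    have hK' : IsCompact ((fun y ↦ δ⁻¹ • (y - F m)) '' K) := hK.image (by fun_prop)
    obtain ⟨t, ht, htK⟩ := Metric.totallyBounded_iff.mp hK'.totallyBounded (ε / 2) (half_pos hε)
    refine ⟨t, ht, ?_⟩
    rintro _ ⟨v, hv, rfl⟩
    rw [mem_ball_zero_iff] at hv
    have hm : m + δ • v ∈ Metric.ball m δ := by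
      rw [mem_ball_iff_norm, add_sub_cancel_left, norm_smul, Real.norm_of_nonneg hδ.le]
      exact mul_lt_of_lt_one_right hδ hv
    obtain ⟨h2, h3⟩ := hball _ hm
    obtain ⟨y, hy, hyt⟩ := mem_iUnion₂.mp (htK (mem_image_of_mem _ (hFK h3)))
    refine mem_iUnion₂.mpr ⟨y, hy, ?_⟩
    rw [mem_ball_iff_norm] at hyt ⊢
    have h4 : ‖A v - δ⁻¹ • (F (m + δ • v) - F m)‖ ≤ ε / 2 := by
      have e : A v - δ⁻¹ • (F (m + δ • v) - F m)
          = -(δ⁻¹ • (F (m + δ • v) - F m - A (m + δ • v - m))) := by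
        rw [add_sub_cancel_left, map_smul, smul_sub _ _ (δ • A v), inv_smul_smul₀ hδ.ne', neg_sub]
      rw [e, norm_neg, norm_smul, norm_inv, Real.norm_of_nonneg hδ.le, inv_mul_le_iff₀ hδ]
      refine h2.trans ?_
      rw [add_sub_cancel_left, norm_smul, Real.norm_of_nonneg hδ.le]
      nlinarith [norm_nonneg v, mul_pos hε hδ]
    calc ‖A v - y‖ ≤ ‖A v - δ⁻¹ • (F (m + δ • v) - F m)‖ + ‖δ⁻¹ • (F (m + δ • v) - F m) - y‖ :=
          norm_sub_le_norm_sub_add_norm_sub _ _ _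
      _ < ε := by linarith
  refine ⟨closure (A '' Metric.ball 0 1), htb.closure.isCompact_of_isClosed isClosed_closure, ?_⟩
  exact mem_of_superset (Metric.ball_mem_nhds 0 one_pos) fun v hv ↦
    subset_closure (mem_image_of_mem _ hv)

theorem Submodule.exists_le_norm_sub {N : Submodule ℝ E} [FiniteDimensional ℝ N] {e : E}
    (he : e ∉ N) : ∃ a : ℝ, ∃ z ∈ N, ‖a • e - z‖ ≤ 2 ∧ ∀ w ∈ N, 1 ≤ ‖a • e - z - w‖ := by
  have hcl : IsClosed (N : Set E) := N.closed_of_finiteDimensional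
  have hd : 0 < Metric.infDist e N :=
    (hcl.notMem_iff_infDist_pos ⟨0, N.zero_mem⟩).mp he
  obtain ⟨z, hz, hez⟩ := (Metric.infDist_lt_iff (s := (N : Set E)) ⟨0, N.zero_mem⟩).mp
    (show Metric.infDist e N < 2 * Metric.infDist e N by linarith)
  set d := Metric.infDist e N
  rw [dist_eq_norm] at hez
  refine ⟨d⁻¹, d⁻¹ • z, N.smul_mem _ hz, ?_, fun w hw ↦ ?_⟩
  · rw [← smul_sub, norm_smul, norm_inv, Real.norm_of_nonneg hd.le, inv_mul_le_iff₀ hd]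
    linarith
  · have h1 : d⁻¹ • e - d⁻¹ • z - w = d⁻¹ • (e - (z + d • w)) := by
      rw [smul_sub, smul_add, inv_smul_smul₀ hd.ne']; abel
    rw [h1, norm_smul, norm_inv, Real.norm_of_nonneg hd.le, le_inv_mul_iff₀ hd, mul_one,
      ← dist_eq_norm]
    exact Metric.infDist_le_dist_of_mem (N.add_mem hz (N.smul_mem _ hw))

theorem IsCompactOperator.exists_invariant_submodule {A : E →L[ℝ] E} (hA : IsCompactOperator A) :
    ∃ N : Submodule ℝ E, FiniteDimensional ℝ N ∧ (∀ v ∈ N, A v ∈ N) ∧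
      ∀ e, ∀ l : ℝ, 1 ≤ l → A e - l • e ∈ N → e ∈ N := by
  by_contra! hcon
  have hstep : ∀ N : {N : Submodule ℝ E // FiniteDimensional ℝ N ∧ ∀ v ∈ N, A v ∈ N},
      ∃ y : E, ‖y‖ ≤ 2 ∧ (∀ w ∈ N.1, 1 ≤ ‖y - w‖) ∧ ∃ l : ℝ, 1 ≤ l ∧ A y - l • y ∈ N.1 := by
    rintro ⟨N, hN, hAN⟩
    obtain ⟨e, l, hl, hle, heN⟩ := hcon N hN hAN
    obtain ⟨a, z, hz, hle2, h1⟩ := N.exists_le_norm_sub heN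
    refine ⟨a • e - z, hle2, h1, l, hl, ?_⟩
    have h2 : A (a • e - z) - l • (a • e - z) = a • (A e - l • e) - (A z - l • z) := by
      rw [map_sub, map_smul]; module
    rw [h2]
    exact N.sub_mem (N.smul_mem _ hle) (N.sub_mem (hAN z hz) (N.smul_mem _ hz))
  choose y hy2 hy1 l hl hAy using hstep
  let next (N : {N : Submodule ℝ E // FiniteDimensional ℝ N ∧ ∀ v ∈ N, A v ∈ N}) :
      {N : Submodule ℝ E // FiniteDimensional ℝ N ∧ ∀ v ∈ N, A v ∈ N} :=
    ⟨N.1 ⊔ Submodule.span ℝ {y N}, by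
      have := N.2.1
      infer_instance, by
      intro v hv
      obtain ⟨a, ha, b, hb, rfl⟩ := Submodule.mem_sup.mp hv
      obtain ⟨c, rfl⟩ := Submodule.mem_span_singleton.mp hb
      have h2 : A (a + c • y N) = (A a + c • (A (y N) - l N • y N)) + (c * l N) • y N := by
        rw [map_add, map_smul]; module
      rw [h2]
      exact Submodule.add_mem_sup (N.1.add_mem (N.2.2 a ha) (N.1.smul_mem _ (hAy N)))
        (Submodule.smul_mem _ _ (Submodule.mem_span_singleton_self _))⟩
  let N (k : ℕ) : {N : Submodule ℝ E // FiniteDimensional ℝ N ∧ ∀ v ∈ N, A v ∈ N} :=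
    next^[k] ⟨⊥, inferInstance, by simp⟩
  have hNsucc (k : ℕ) : N (k + 1) = next (N k) := Function.iterate_succ_apply' _ _ _
  have hmono : Monotone fun k ↦ (N k).1 := monotone_nat_of_le_succ fun k ↦ by
    rw [hNsucc]; exact le_sup_left
  have hyN (k : ℕ) : y (N k) ∈ (N (k + 1)).1 := by
    rw [hNsucc]
    exact Submodule.mem_sup_right (Submodule.mem_span_singleton_self _)
  have hsep : ∀ j k, j < k → 1 ≤ ‖A (y (N k)) - A (y (N j))‖ := by
    intro j k hjk
    have h1 : A (y (N j)) ∈ (N k).1 := hmono hjk ((N (j + 1)).2.2 _ (hyN j))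
    have hl0 : 0 < l (N k) := zero_lt_one.trans_le (hl _)
    set w := (l (N k))⁻¹ • (A (y (N j)) - (A (y (N k)) - l (N k) • y (N k))) with hw
    have h2 : A (y (N k)) - A (y (N j)) = l (N k) • (y (N k) - w) := by
      rw [hw, smul_sub, smul_inv_smul₀ hl0.ne']; abel
    have h3 := hy1 (N k) w ((N k).1.smul_mem _ ((N k).1.sub_mem h1 (hAy (N k))))
    rw [h2, norm_smul, Real.norm_of_nonneg hl0.le]
    nlinarith [hl (N k)]
  obtain ⟨K, hK, hAK⟩ := hA.image_closedBall_subset_compact 2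
  obtain ⟨a, -, φ, hφ, hlim⟩ := hK.tendsto_subseq (x := fun k ↦ A (y (N k)))
    fun k ↦ hAK (mem_image_of_mem _ (mem_closedBall_zero_iff.mpr (hy2 _)))
  obtain ⟨n, hn⟩ := Metric.cauchySeq_iff'.mp hlim.cauchySeq 1 one_pos
  have h1 := hn (n + 1) n.le_succ
  rw [dist_eq_norm] at h1
  exact (hsep _ _ (hφ n.lt_succ_self)).not_gt h1

theorem IsCompactOperator.exists_finiteRank_homotopy {A : E →L[ℝ] E} (hA : IsCompactOperator A)
    (h : ∀ v, v ≠ 0 → A v ≠ v) : ∃ (N : Submodule ℝ E) (B : E →L[ℝ] E), FiniteDimensional ℝ N ∧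
      (∀ v, B v ∈ N) ∧ ∀ t ∈ Icc (0 : ℝ) 1, ∀ v, (1 - t) • A v + t • B v = v → v = 0 := by
  obtain ⟨N, hN, hAN, hmax⟩ := hA.exists_invariant_submodule
  obtain ⟨P, hP⟩ := Submodule.ClosedComplemented.of_finiteDimensional (𝕜 := ℝ) N
  refine ⟨N, A.comp (N.subtypeL.comp P), hN, fun v ↦ hAN _ (P v).2, fun t ht v hv ↦ ?_⟩
  set w := v - P v with hw
  have hwN : w ∈ N := by
    have h1 : w - (1 - t) • A w = A (P v) - P v := by
      have h2 : (1 - t) • A v + t • A (P v) = v := by simpa using hv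
      have h3 : A w = A v - A (P v) := by rw [hw, map_sub]
      rw [h3, hw, smul_sub]
      nth_rewrite 1 [← h2]
      module
    have h4 : w - (1 - t) • A w ∈ N := by
      rw [h1]; exact N.sub_mem (hAN _ (P v).2) (P v).2
    rcases ht.2.eq_or_lt with rfl | ht1
    · simpa using h4
    · have h5 : 0 < 1 - t := sub_pos.mpr ht1
      refine hmax w (1 - t)⁻¹ ((one_le_inv₀ h5).mpr (by linarith [ht.1])) ?_
      have h6 : A w - (1 - t)⁻¹ • w = -((1 - t)⁻¹ • (w - (1 - t) • A w)) := by
        rw [smul_sub _ w, inv_smul_smul₀ h5.ne']; abel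
      rw [h6]
      exact N.neg_mem (N.smul_mem _ h4)
  have hPw : P w = 0 := by
    rw [hw, map_sub, hP, sub_self]
  have hw0 : w = 0 := by
    have := hP ⟨w, hwN⟩
    rw [hPw] at this
    simpa using (congrArg Subtype.val this).symm
  have hv' : (P v : E) = v := (sub_eq_zero.mp (hw ▸ hw0)).symm
  by_contra hv0
  refine h v hv0 ?_
  have h2 : (1 - t) • A v + t • A (P v) = v := by simpa using hv
  rw [hv', ← add_smul, sub_add_cancel, one_smul] at h2
  exact h2

end CompactLinear

section LocalIndex

variable {E : Type*} [NormedAddCommGroup E] [NormedSpace ℝ E]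

/-- The index of the fixed point `x₀` of the affine map `x ↦ x₀ + A (x - x₀)`, computed in the
span of the finite set `s`. -/
noncomputable def linearIndex (s : Finset E) (A : E →L[ℝ] E) (x₀ : E) : ℝ :=
  finiteIndex s (fun x ↦ x₀ + A (x - x₀)) (Metric.ball x₀ 1)

theorem IsCompactOperator.isCompactMapOn_affine {A : E →L[ℝ] E} (hA : IsCompactOperator A)
    (x₀ : E) {S : Set E} (hS : S ⊆ Metric.closedBall x₀ 1) :
    IsCompactMapOn (fun x ↦ x₀ + A (x - x₀)) S := by
  obtain ⟨K, hK, hAK⟩ := hA.image_closedBall_subset_compact 1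
  refine ⟨by fun_prop, (x₀ + ·) '' K, hK.image (by fun_prop), fun x hx ↦ ?_⟩
  refine mem_image_of_mem _ (hAK (mem_image_of_mem _ ?_))
  rw [mem_closedBall_zero_iff, ← mem_closedBall_iff_norm]
  exact hS hx

omit [NormedSpace ℝ E] in
theorem frontier_ball_subset_closedBall (x : E) (r : ℝ) :
    frontier (Metric.ball x r) ⊆ Metric.closedBall x r :=
  frontier_subset_closure.trans Metric.closure_ball_subset_closedBall

omit [NormedSpace ℝ E] in
theorem norm_sub_eq_of_mem_frontier_ball {x z : E} {r : ℝ} (hz : z ∈ frontier (Metric.ball x r)) :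
    ‖z - x‖ = r :=
  mem_sphere_iff_norm.mp (Metric.frontier_ball_subset_sphere hz)

theorem eventually_linearIndex {A : E →L[ℝ] E} (hA : IsCompactOperator A)
    (h : ∀ v, v ≠ 0 → A v ≠ v) (x₀ : E) :
    ∀ᶠ s : Finset E in atTop, linearIndex s A x₀ = 1 ∨ linearIndex s A x₀ = -1 := by
  obtain ⟨N, B, hN, hBN, hAB⟩ := hA.exists_finiteRank_homotopy h
  have hB : IsCompactOperator B := by
    refine ⟨_, isCompact_closedBall (0 : N) ‖B‖ |>.image continuous_subtype_val, ?_⟩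
    refine mem_of_superset (Metric.ball_mem_nhds 0 one_pos) fun v hv ↦ ⟨⟨B v, hBN v⟩, ?_, rfl⟩
    rw [mem_closedBall_zero_iff]
    rw [mem_ball_zero_iff] at hv
    exact B.unit_le_opNorm v hv.le
  have hfr := frontier_ball_subset_closedBall x₀ 1
  have hne : ∀ x ∈ frontier (Metric.ball x₀ 1), ∀ t ∈ Icc (0 : ℝ) 1,
      x ≠ (1 - t) • (x₀ + A (x - x₀)) + t • (x₀ + B (x - x₀)) := by
    intro x hx t ht hxt
    have h1 := hAB t ht (x - x₀) (by
      nth_rewrite 3 [hxt]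
      module)
    have h2 := norm_sub_eq_of_mem_frontier_ball hx
    rw [h1, norm_zero] at h2
    exact zero_ne_one h2
  filter_upwards [eventually_finiteIndex_eq_of_homotopy Metric.isOpen_ball Metric.isBounded_ball
      (hA.isCompactMapOn_affine x₀ hfr) (hB.isCompactMapOn_affine x₀ hfr) hne,
    eventually_finiteIndex_finiteRank hBN
      (fun v hv ↦ hAB 1 (right_mem_Icc.mpr zero_le_one) v (by simpa using hv))
      Metric.isOpen_ball Metric.isBounded_ball (Metric.mem_ball_self (x := x₀) one_pos)]
    with s h1 h2
  rwa [linearIndex, h1]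

theorem eventually_finiteIndex_ball_eq_linearIndex {A : E →L[ℝ] E} (hA : IsCompactOperator A)
    (h : ∀ v, v ≠ 0 → A v ≠ v) (x₀ : E) {r : ℝ} (hr : 0 < r) (hr1 : r ≤ 1) :
    ∀ᶠ s : Finset E in atTop,
      finiteIndex s (fun x ↦ x₀ + A (x - x₀)) (Metric.ball x₀ r) = linearIndex s A x₀ := by
  filter_upwards [eventually_finiteIndex_eq_sum (Metric.isOpen_ball (x := x₀) (ε := 1))
    Metric.isBounded_ball {()} (fun _ ↦ Metric.ball x₀ r) (fun _ _ ↦ Metric.isOpen_ball)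
    (fun _ _ ↦ Metric.ball_subset_ball hr1) (by simp)
    (hA.isCompactMapOn_affine x₀ Metric.closure_ball_subset_closedBall) fun x _ hx hfix ↦
      h (x - x₀) (fun h0 ↦ hx () (Finset.mem_singleton_self _) (by
        rw [sub_eq_zero.mp h0]
        exact Metric.mem_ball_self hr)) (eq_sub_of_add_eq' hfix)]
    with s hs
  simpa [linearIndex] using hs.symm

open Classical in
/-- The eventual value of the index of an isolated fixed point with derivative `A`, along an
ultrafilter of finite dimensional subspaces. -/
noncomputable def localSign (A : E →L[ℝ] E) (x₀ : E) : ℝ :=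
  if ∀ᶠ s in (Ultrafilter.of (atTop : Filter (Finset E)) : Filter (Finset E)),
    linearIndex s A x₀ = 1 then 1 else -1

theorem localSign_eq (A : E →L[ℝ] E) (x₀ : E) : localSign A x₀ = 1 ∨ localSign A x₀ = -1 := by
  unfold localSign
  split_ifs <;> simp

open Classical in
theorem eventually_linearIndex_eq_localSign {A : E →L[ℝ] E} (hA : IsCompactOperator A)
    (h : ∀ v, v ≠ 0 → A v ≠ v) (x₀ : E) :
    ∀ᶠ s in (Ultrafilter.of (atTop : Filter (Finset E)) : Filter (Finset E)),
      linearIndex s A x₀ = localSign A x₀ := by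
  have h1 := (eventually_linearIndex hA h x₀).filter_mono (Ultrafilter.of_le _)
  unfold localSign
  split_ifs with hs
  · exact hs
  · exact (Ultrafilter.eventually_or.mp h1).resolve_left hs

end LocalIndex

section RegularMap

variable {E : Type*} [NormedAddCommGroup E] [NormedSpace ℝ E]

/-- `F` is a compact map on the closure of the open set `M`, differentiable in `M`, and `1` is not
an eigenvalue of its derivative at the points of `M`. -/
structure IsCompactRegularOn (F : E → E) (F' : E → E →L[ℝ] E) (M : Set E) : Prop where
  isOpen : IsOpen M
  isCompactMapOn : IsCompactMapOn F (closure M)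
  hasFDerivAt : ∀ m ∈ M, HasFDerivAt F (F' m) m
  apply_ne : ∀ m ∈ M, ∀ v, v ≠ 0 → F' m v ≠ v

omit [NormedSpace ℝ E] in
theorem IsCompactMapOn.add_const {F : E → E} {S : Set E} (h : IsCompactMapOn F S) (y : E) :
    IsCompactMapOn (fun x ↦ F x + y) S := by
  obtain ⟨hc, K, hK, hFK⟩ := h
  exact ⟨hc.add continuousOn_const, (· + y) '' K, hK.image (by fun_prop),
    fun x hx ↦ mem_image_of_mem _ (hFK hx)⟩

namespace IsCompactRegularOn

variable [CompleteSpace E] {F : E → E} {F' : E → E →L[ℝ] E} {M : Set E}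

theorem isCompactOperator (h : IsCompactRegularOn F F' M) {x : E} (hx : x ∈ M) :
    IsCompactOperator (F' x) := by
  obtain ⟨-, K, hK, hFK⟩ := h.isCompactMapOn
  exact (h.hasFDerivAt x hx).isCompactOperator hK (h.isOpen.mem_nhds hx)
    (hFK.mono_left subset_closure)

theorem exists_local_bound (h : IsCompactRegularOn F F' M) {x : E} (hx : x ∈ M) :
    ∃ c > 0, ∃ r > 0, r ≤ 1 ∧ Metric.closedBall x r ⊆ M ∧ ∀ z ∈ Metric.closedBall x r,
      ∀ t ∈ Icc (0 : ℝ) 1,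
        c * ‖z - x‖ ≤ ‖z - ((1 - t) • (F z + (x - F x)) + t • (x + F' x (z - x)))‖ := by
  obtain ⟨c, hc, hle⟩ := (h.isCompactOperator hx).exists_pos_le_norm_sub (h.apply_ne x hx)
  have h1 := (h.hasFDerivAt x hx).isLittleO.def (half_pos hc)
  obtain ⟨δ, hδ, hball⟩ := Metric.nhds_basis_closedBall.mem_iff.mp
    (inter_mem h1 (h.isOpen.mem_nhds hx))
  refine ⟨c / 2, half_pos hc, min δ 1, by positivity, min_le_right _ _, fun z hz ↦
    (hball (Metric.closedBall_subset_closedBall (min_le_left _ _) hz)).2, fun z hz t ht ↦ ?_⟩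
  have h2 : ‖F z - F x - F' x (z - x)‖ ≤ c / 2 * ‖z - x‖ :=
    (hball (Metric.closedBall_subset_closedBall (min_le_left _ _) hz)).1
  have e : z - ((1 - t) • (F z + (x - F x)) + t • (x + F' x (z - x)))
      = (z - x - F' x (z - x)) - (1 - t) • (F z - F x - F' x (z - x)) := by
    module
  have h3 := norm_sub_norm_le (z - x - F' x (z - x)) ((1 - t) • (F z - F x - F' x (z - x)))
  have h4 : ‖(1 - t) • (F z - F x - F' x (z - x))‖ ≤ c / 2 * ‖z - x‖ := by
    rw [norm_smul, Real.norm_of_nonneg (sub_nonneg.mpr ht.2)]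
    refine (mul_le_of_le_one_left (norm_nonneg _) ?_).trans h2
    linarith [ht.1]
  rw [e]
  linarith [hle (z - x)]

theorem exists_norm_sub_le (h : IsCompactRegularOn F F' M) {x : E} (hx : x ∈ M) :
    ∃ c > 0, ∃ r > 0, Metric.closedBall x r ⊆ M ∧ ∀ z ∈ Metric.closedBall x r,
      c * ‖z - x‖ ≤ ‖(z - F z) - (x - F x)‖ := by
  obtain ⟨c, hc, r, hr, -, hrM, hle⟩ := h.exists_local_bound hx
  refine ⟨c, hc, r, hr, hrM, fun z hz ↦ ?_⟩
  have := hle z hz 0 (left_mem_Icc.mpr zero_le_one)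
  convert this using 2
  module

theorem eventually_finiteIndex_eq_localSign (h : IsCompactRegularOn F F' M) {x : E} (hx : x ∈ M) :
    ∃ r₀ > 0, Metric.closedBall x r₀ ⊆ M ∧ ∀ r > 0, r ≤ r₀ →
      ∀ᶠ s in (Ultrafilter.of (atTop : Filter (Finset E)) : Filter (Finset E)),
        finiteIndex s (fun z ↦ F z + (x - F x)) (Metric.ball x r) = localSign (F' x) x := by
  obtain ⟨c, hc, r₀, hr₀, hr1, hrM, hle⟩ := h.exists_local_bound hx
  refine ⟨r₀, hr₀, hrM, fun r hr hrr ↦ ?_⟩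
  have hA := h.isCompactOperator hx
  have hfr : frontier (Metric.ball x r) ⊆ Metric.closedBall x r₀ :=
    (frontier_ball_subset_closedBall x r).trans (Metric.closedBall_subset_closedBall hrr)
  have hne : ∀ z ∈ frontier (Metric.ball x r), ∀ t ∈ Icc (0 : ℝ) 1,
      z ≠ (1 - t) • (F z + (x - F x)) + t • (x + F' x (z - x)) := by
    intro z hz t ht hzt
    have h4 := hle z (hfr hz) t ht
    rw [← hzt, sub_self, norm_zero, norm_sub_eq_of_mem_frontier_ball hz] at h4
    exact (mul_pos hc hr).not_ge h4
  filter_upwards [Ultrafilter.of_le _ (eventually_finiteIndex_eq_of_homotopy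
      (Metric.isOpen_ball (x := x) (ε := r)) Metric.isBounded_ball
      ((h.isCompactMapOn.mono (hfr.trans (hrM.trans subset_closure))).add_const (x - F x))
      (hA.isCompactMapOn_affine x (hfr.trans (Metric.closedBall_subset_closedBall hr1)))
      hne),
    Ultrafilter.of_le _ (eventually_finiteIndex_ball_eq_linearIndex hA (h.apply_ne x hx) x hr
      (hrr.trans hr1)), eventually_linearIndex_eq_localSign hA (h.apply_ne x hx) x]
    with s h1 h2 h3
  exact h1.trans (h2.trans h3)

theorem finite_fixedPoints (h : IsCompactRegularOn F F' M) {S : Set E} (hS : IsClosed S)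
    (hSM : S ⊆ closure M) (y : E) (hfix : ∀ x ∈ S, F x + y = x → x ∈ M) :
    {x ∈ S | F x + y = x}.Finite := by
  obtain ⟨hc, K, hK, hFK⟩ := (h.isCompactMapOn.mono hSM).add_const y
  have hZ : IsCompact {x ∈ S | F x + y = x} := by
    refine hK.of_isClosed_subset ?_ fun x hx ↦ ?_
    · have := (hc.sub continuousOn_id).preimage_isClosed_of_isClosed hS
          (isClosed_singleton (x := 0))
      convert this using 1
      ext x
      simp [sub_eq_zero]
    · rw [← hx.2]
      exact hFK hx.1
  have hiso : ∀ x ∈ {x ∈ S | F x + y = x}, ∃ V ∈ 𝓝 x, V ∩ {x ∈ S | F x + y = x} ⊆ {x} := by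
    intro x hx
    obtain ⟨c, hc, r, hr, -, hle⟩ := h.exists_norm_sub_le (hfix x hx.1 hx.2)
    refine ⟨_, Metric.closedBall_mem_nhds x hr, fun z hz ↦ ?_⟩
    have h1 := hle z hz.1
    have h2 : (z - F z) - (x - F x) = 0 := by
      rw [sub_eq_of_eq_add' hz.2.2.symm, sub_eq_of_eq_add' hx.2.symm, sub_self]
    rw [h2, norm_zero] at h1
    have h3 : ‖z - x‖ ≤ 0 := by
      by_contra! h4
      exact (mul_pos hc h4).not_ge h1
    exact sub_eq_zero.mp (norm_le_zero_iff.mp h3)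
  choose! V hV hVx using hiso
  obtain ⟨t, ht, hZt⟩ := hZ.elim_nhds_subcover V hV
  refine t.finite_toSet.subset fun x hx ↦ ?_
  obtain ⟨z, hz, hxz⟩ := mem_iUnion₂.mp (hZt hx)
  rw [hVx z (ht z hz) ⟨hxz, hx⟩]
  exact hz

theorem eventually_finiteIndex_eq_sum_localSign (h : IsCompactRegularOn F F' M) {U : Set E}
    (hU : IsOpen U) (hb : Bornology.IsBounded U) (hUM : closure U ⊆ closure M) (y : E)
    (hfix : ∀ x ∈ closure U, F x + y = x → x ∈ U ∧ x ∈ M) :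
    ∃ t : Finset E, (∀ x, x ∈ t ↔ x ∈ U ∧ F x + y = x) ∧
      ∀ᶠ s in (Ultrafilter.of (atTop : Filter (Finset E)) : Filter (Finset E)),
        finiteIndex s (fun z ↦ F z + y) U = ∑ x ∈ t, localSign (F' x) x := by
  have hfin := h.finite_fixedPoints isClosed_closure hUM y fun x hx hxy ↦ (hfix x hx hxy).2
  set t := hfin.toFinset with htdef
  have hmem : ∀ x, x ∈ t ↔ x ∈ U ∧ F x + y = x := fun x ↦ by
    rw [htdef, Finite.mem_toFinset, mem_ofPred_eq]
    exact ⟨fun hx ↦ ⟨(hfix x hx.1 hx.2).1, hx.2⟩, fun hx ↦ ⟨subset_closure hx.1, hx.2⟩⟩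
  have htM : ∀ x ∈ t, x ∈ M := fun x hx ↦
    (hfix x (subset_closure ((hmem x).mp hx).1) ((hmem x).mp hx).2).2
  refine ⟨t, hmem, ?_⟩
  have hloc : ∀ x ∈ t, ∃ r₀ > 0, Metric.ball x r₀ ⊆ U ∧ ∀ r > 0, r ≤ r₀ →
      ∀ᶠ s in (Ultrafilter.of (atTop : Filter (Finset E)) : Filter (Finset E)),
        finiteIndex s (fun z ↦ F z + y) (Metric.ball x r) = localSign (F' x) x := by
    intro x hx
    obtain ⟨r₁, hr₁, -, h1⟩ := h.eventually_finiteIndex_eq_localSign (htM x hx)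
    obtain ⟨r₂, hr₂, h2⟩ := Metric.isOpen_iff.mp hU x ((hmem x).mp hx).1
    have hy : x - F x = y := sub_eq_of_eq_add' ((hmem x).mp hx).2.symm
    refine ⟨min r₁ r₂, lt_min hr₁ hr₂, (Metric.ball_subset_ball (min_le_right _ _)).trans h2,
      fun r hr hrr ↦ ?_⟩
    have h3 := h1 r hr (hrr.trans (min_le_left _ _))
    rwa [hy] at h3
  choose! r₀ hr₀ hrU hidx using hloc
  have hev : ∀ᶠ r : ℝ in 𝓝[>] 0, 0 < r ∧ (∀ x ∈ t, r < r₀ x) ∧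
      ∀ x ∈ t, ∀ z ∈ t, x ≠ z → r < dist x z / 2 := by
    have hpos {a : ℝ} (ha : 0 < a) : ∀ᶠ r : ℝ in 𝓝[>] 0, r < a :=
      nhdsWithin_le_nhds (Iio_mem_nhds ha)
    refine eventually_mem_nhdsWithin.and (((eventually_all_finset t).mpr fun x hx ↦
      hpos (hr₀ x hx)).and ?_)
    refine (eventually_all_finset t).mpr fun x _ ↦ (eventually_all_finset t).mpr fun z _ ↦ ?_
    by_cases hxz : x = z
    · simp [hxz]
    · filter_upwards [hpos (half_pos (dist_pos.mpr hxz))] with r hr _ using hr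
  obtain ⟨r, hr, hrr, hsep⟩ := hev.exists
  filter_upwards [Ultrafilter.of_le _ (eventually_finiteIndex_eq_sum hU hb t
      (fun x ↦ Metric.ball x r) (fun _ _ ↦ Metric.isOpen_ball)
      (fun x hx ↦ (Metric.ball_subset_ball (hrr x hx).le).trans (hrU x hx))
      (fun x hx z hz hxz ↦ Metric.ball_disjoint_ball (by linarith [hsep x hx z hz hxz]))
      ((h.isCompactMapOn.mono hUM).add_const y) fun x hx hxt hxy ↦
        hxt x ((hmem x).mpr ⟨(hfix x hx hxy).1, hxy⟩) (Metric.mem_ball_self hr)),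
    (eventually_all_finset t).mpr fun x hx ↦ hidx x hx r hr (hrr x hx).le] with s h1 h2
  exact h1.trans (Finset.sum_congr rfl h2)

theorem exists_preimage_localSign_eq (h : IsCompactRegularOn F F' M) {x₀ : E} (hx₀ : x₀ ∈ M)
    {r : ℝ} (hr : 0 < r) : ∃ δ > 0, ∀ y, ‖y - (x₀ - F x₀)‖ < δ →
      ∃ x ∈ Metric.ball x₀ r, x ∈ M ∧ x - F x = y ∧ localSign (F' x) x = localSign (F' x₀) x₀ := by
  obtain ⟨c, hc, r₁, hr₁, -, hle⟩ := h.exists_norm_sub_le hx₀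
  obtain ⟨r₂, hr₂, hrM, hidx⟩ := h.eventually_finiteIndex_eq_localSign hx₀
  obtain ⟨ρ, hρ, hρr, hρ₁, hρ₂⟩ : ∃ ρ > 0, ρ ≤ r ∧ ρ ≤ r₁ ∧ ρ ≤ r₂ :=
    ⟨min r (min r₁ r₂), by positivity, min_le_left _ _, (min_le_right _ _).trans (min_le_left _ _),
      (min_le_right _ _).trans (min_le_right _ _)⟩
  have hfr : frontier (Metric.ball x₀ ρ) ⊆ Metric.closedBall x₀ ρ :=
    frontier_ball_subset_closedBall x₀ ρ
  have hclM : closure (Metric.ball x₀ ρ) ⊆ M :=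
    Metric.closure_ball_subset_closedBall.trans
      ((Metric.closedBall_subset_closedBall hρ₂).trans hrM)
  have hbound : ∀ z ∈ frontier (Metric.ball x₀ ρ), c * ρ ≤ ‖(z - F z) - (x₀ - F x₀)‖ := by
    intro z hz
    have := hle z (Metric.closedBall_subset_closedBall hρ₁ (hfr hz))
    rwa [norm_sub_eq_of_mem_frontier_ball hz] at this
  refine ⟨c * ρ, mul_pos hc hρ, fun y hy ↦ ?_⟩
  obtain ⟨t, ht, hsum⟩ := h.eventually_finiteIndex_eq_sum_localSign
    (Metric.isOpen_ball (x := x₀) (ε := ρ)) Metric.isBounded_ball (hclM.trans subset_closure) y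
    fun x hx hxy ↦ ⟨by
      by_contra hxb
      have h1 := hbound x ⟨hx, by rwa [Metric.isOpen_ball.interior_eq]⟩
      rw [sub_eq_of_eq_add' hxy.symm] at h1
      exact hy.not_ge h1, hclM hx⟩
  have hcomp := h.isCompactMapOn.mono (frontier_subset_closure.trans (hclM.trans subset_closure))
  have hhom := eventually_finiteIndex_eq_of_homotopy (Metric.isOpen_ball (x := x₀) (ε := ρ))
    Metric.isBounded_ball (hcomp.add_const (x₀ - F x₀)) (hcomp.add_const y) fun z hz τ hτ hzτ ↦ by
      have h1 := hbound z hz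
      have h2 : (z - F z) - (x₀ - F x₀) = τ • (y - (x₀ - F x₀)) := by
        nth_rewrite 1 [hzτ]
        module
      rw [h2, norm_smul, Real.norm_of_nonneg hτ.1] at h1
      exact (h1.trans (mul_le_of_le_one_left (norm_nonneg _) hτ.2)).not_gt hy
  obtain ⟨s, h1, h2, h3⟩ :=
    (hsum.and ((hhom.filter_mono (Ultrafilter.of_le _)).and (hidx ρ hρ hρ₂))).exists
  have hsum' : ∑ x ∈ t, localSign (F' x) x = localSign (F' x₀) x₀ := by
    rw [← h1, ← h3]; exact h2.symm
  obtain ⟨x, hx, hxs⟩ : ∃ x ∈ t, localSign (F' x) x = localSign (F' x₀) x₀ := by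
    by_contra! hne
    have h4 : ∀ x ∈ t, localSign (F' x) x = -localSign (F' x₀) x₀ := by
      intro x hx
      have := hne x hx
      rcases localSign_eq (F' x) x with h5 | h5 <;> rcases localSign_eq (F' x₀) x₀ with h6 | h6 <;>
        simp_all
    rw [Finset.sum_congr rfl h4, Finset.sum_const, nsmul_eq_mul] at hsum'
    have h7 : (0 : ℝ) ≤ t.card := Nat.cast_nonneg _
    rcases localSign_eq (F' x₀) x₀ with h6 | h6 <;> rw [h6] at hsum' <;> linarith
  obtain ⟨hxb, hxy⟩ := (ht x).mp hx
  exact ⟨x, Metric.ball_subset_ball hρr hxb, hclM (subset_closure hxb),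
    sub_eq_of_eq_add' hxy.symm, hxs⟩

theorem exists_sum_localSign_eq_one (h : IsCompactRegularOn F F' M) (hne : M.Nonempty)
    (hb : Bornology.IsBounded M) (hconv : Convex ℝ M) (hmaps : MapsTo F (closure M) (closure M))
    (hbdry : ∀ m ∈ frontier M, F m ≠ m) :
    ∃ t : Finset E, (∀ x, x ∈ t ↔ x ∈ M ∧ F x = x) ∧ ∑ x ∈ t, localSign (F' x) x = 1 := by
  obtain ⟨m₀, hm₀⟩ := hne
  obtain ⟨t, ht, hsum⟩ := h.eventually_finiteIndex_eq_sum_localSign h.isOpen hb subset_rfl 0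
    fun x hx hxy ↦ by
      have : x ∈ M := by
        by_contra hxM
        exact hbdry x ⟨hx, by rwa [h.isOpen.interior_eq]⟩ (by simpa using hxy)
      exact ⟨this, this⟩
  have hconst : IsCompactMapOn (fun _ ↦ m₀) (frontier M) :=
    ⟨continuousOn_const, {m₀}, isCompact_singleton, fun _ _ ↦ rfl⟩
  have hhom := eventually_finiteIndex_eq_of_homotopy h.isOpen hb
    ((h.isCompactMapOn.mono frontier_subset_closure).add_const 0) hconst fun x hx τ hτ hxτ ↦ by
      rcases hτ.1.eq_or_lt with rfl | hτ0
      · exact hbdry x hx (by simpa using hxτ.symm)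
      · refine hx.2 ?_
        have h1 := hconv.combo_closure_interior_mem_interior (hmaps hx.1)
          (by rwa [h.isOpen.interior_eq] : m₀ ∈ interior M) (sub_nonneg.mpr hτ.2) hτ0 (by ring)
        rw [add_zero] at hxτ
        rwa [← hxτ] at h1
  obtain ⟨s, h1, h2, h3⟩ := (hsum.and ((hhom.filter_mono (Ultrafilter.of_le _)).and
    (Ultrafilter.of_le _ (eventually_finiteIndex_const h.isOpen hb hm₀)))).exists
  exact ⟨t, fun x ↦ by simpa using ht x, by rw [← h1, ← h3]; exact h2⟩

end IsCompactRegularOn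

end RegularMap

section Variational

/-- Ekeland's variational principle for the distance to a point. -/
theorem IsClosed.exists_ekeland_dist {X : Type*} [MetricSpace X] [CompleteSpace X] {S : Set X}
    (hS : IsClosed S) {s₀ : X} (hs₀ : s₀ ∈ S) (y : X) {κ : ℝ} (hκ : 0 < κ) :
    ∃ s ∈ S, dist s y ≤ dist s₀ y ∧ ∀ u ∈ S, dist s y ≤ dist u y + κ * dist u s := by
  have hnext : ∀ s ∈ S, ∃ v ∈ S, dist v y + κ * dist v s ≤ dist s y ∧
      ∀ u ∈ S, dist u y + κ * dist u s ≤ dist s y → dist v y ≤ (dist s y + dist u y) / 2 := by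
    intro s hs
    set A := (dist · y) '' {u ∈ S | dist u y + κ * dist u s ≤ dist s y} with hA
    have hbdd : BddBelow A := ⟨0, by rintro _ ⟨u, -, rfl⟩; exact dist_nonneg⟩
    have hle : ∀ u ∈ S, dist u y + κ * dist u s ≤ dist s y → sInf A ≤ dist u y := fun u hu h ↦
      csInf_le hbdd ⟨u, ⟨hu, h⟩, rfl⟩
    have hself : dist s y + κ * dist s s ≤ dist s y := by simp
    rcases (hle s hs hself).lt_or_eq with hlt | heq
    · obtain ⟨_, ⟨v, ⟨hv, hvs⟩, rfl⟩, hv2⟩ := exists_lt_of_csInf_lt (s := A)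
        ⟨_, s, ⟨hs, hself⟩, rfl⟩ (show sInf A < (dist s y + sInf A) / 2 by linarith)
      exact ⟨v, hv, hvs, fun u hu h ↦ hv2.le.trans (by linarith [hle u hu h])⟩
    · exact ⟨s, hs, hself, fun u hu h ↦ by linarith [hle u hu h]⟩
  choose! next hnS hnle hnmin using hnext
  set x : ℕ → X := fun k ↦ next^[k] s₀ with hx
  have hxs (k : ℕ) : x (k + 1) = next (x k) := Function.iterate_succ_apply' _ _ _
  have hxS (k : ℕ) : x k ∈ S := by
    induction k with
    | zero => exact hs₀
    | succ k ih => rw [hxs]; exact hnS _ ih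
  have hstep (k : ℕ) : dist (x (k + 1)) y + κ * dist (x (k + 1)) (x k) ≤ dist (x k) y := by
    rw [hxs]; exact hnle _ (hxS k)
  have hle (k j : ℕ) : dist (x (k + j)) y + κ * dist (x (k + j)) (x k) ≤ dist (x k) y := by
    induction j with
    | zero => simp
    | succ j ih =>
      have h1 := hstep (k + j)
      have h2 := mul_le_mul_of_nonneg_left
        (dist_triangle (x (k + j + 1)) (x (k + j)) (x k)) hκ.le
      rw [← add_assoc]
      linarith
  have hanti : Antitone fun k ↦ dist (x k) y := antitone_nat_of_succ_le fun k ↦ by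
    have := hstep k
    have h2 : 0 ≤ κ * dist (x (k + 1)) (x k) := by positivity
    linarith
  obtain ⟨L, hL⟩ : ∃ L, Tendsto (fun k ↦ dist (x k) y) atTop (𝓝 L) :=
    ⟨_, tendsto_atTop_ciInf hanti ⟨0, by rintro _ ⟨k, rfl⟩; exact dist_nonneg⟩⟩
  have hcauchy : CauchySeq x := by
    rw [Metric.cauchySeq_iff']
    intro ε hε
    obtain ⟨n, hn⟩ := Metric.cauchySeq_iff'.mp hL.cauchySeq (κ * ε) (by positivity)
    refine ⟨n, fun m hm ↦ ?_⟩
    obtain ⟨j, rfl⟩ := Nat.exists_eq_add_of_le hm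
    have h1 := hn _ hm
    rw [Real.dist_eq, abs_sub_lt_iff] at h1
    have h2 := hle n j
    exact lt_of_mul_lt_mul_left (by linarith [h1.2]) hκ.le
  obtain ⟨s, hs⟩ := cauchySeq_tendsto_of_complete hcauchy
  have hsy : dist s y = L := tendsto_nhds_unique (hs.dist tendsto_const_nhds) hL
  have hsk (k : ℕ) : dist s y + κ * dist s (x k) ≤ dist (x k) y := by
    have h1 : Tendsto (fun j ↦ x (k + j)) atTop (𝓝 s) :=
      hs.comp (tendsto_atTop_mono (fun j ↦ Nat.le_add_left j k) tendsto_id)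
    exact le_of_tendsto' ((h1.dist tendsto_const_nhds).add
      ((h1.dist tendsto_const_nhds).const_mul κ)) (hle k)
  refine ⟨s, hS.mem_of_tendsto hs (Eventually.of_forall hxS), ?_, fun u hu ↦ ?_⟩
  · have h1 : dist s y + κ * dist s s₀ ≤ dist s₀ y := hsk 0
    have h2 : 0 ≤ κ * dist s s₀ := by positivity
    linarith
  · by_contra! hlt
    have h1 (k : ℕ) : dist (x (k + 1)) y ≤ (dist (x k) y + dist u y) / 2 := by
      rw [hxs]
      refine hnmin _ (hxS k) u hu ?_
      have h2 := hsk k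
      have h3 := mul_le_mul_of_nonneg_left (dist_triangle u s (x k)) hκ.le
      linarith
    have h2 := le_of_tendsto_of_tendsto' (hL.comp (tendsto_add_atTop_nat 1))
      ((hL.add_const (dist u y)).div_const 2) h1
    have h3 : 0 ≤ κ * dist u s := by positivity
    linarith

theorem IsClosed.exists_inter_ball_subset_of_subset_iUnion {X : Type*} [MetricSpace X]
    [CompleteSpace X] {S : Set X} (hS : IsClosed S) (hne : S.Nonempty) {A : ℕ → Set X}
    (hA : ∀ n, IsClosed (S ∩ A n)) (hSA : S ⊆ ⋃ n, A n) :
    ∃ n, ∃ x ∈ S, ∃ ε > 0, S ∩ Metric.ball x ε ⊆ A n := by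
  have : CompleteSpace S := hS.completeSpace_coe
  have : Nonempty S := hne.to_subtype
  obtain ⟨n, x, hx⟩ := nonempty_interior_of_iUnion_of_closed
    (f := fun n ↦ (Subtype.val ⁻¹' (S ∩ A n) : Set S))
    (fun n ↦ (hA n).preimage continuous_subtype_val) (eq_univ_of_forall fun x ↦ by
      obtain ⟨n, hn⟩ := mem_iUnion.mp (hSA x.2)
      exact mem_iUnion.mpr ⟨n, x.2, hn⟩)
  obtain ⟨ε, hε, hball⟩ := Metric.mem_nhds_iff.mp (mem_interior_iff_mem_nhds.mp hx)
  exact ⟨n, x, x.2, ε, hε, fun z hz ↦ (hball (show (⟨z, hz.1⟩ : S) ∈ Metric.ball x ε from hz.2)).2⟩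

theorem IsPreconnected.eq_of_eventually_eq {X α : Type*} [TopologicalSpace X] {S : Set X}
    (hS : IsPreconnected S) {σ : X → α} (h : ∀ x ∈ S, ∀ᶠ u in 𝓝 x, σ u = σ x) {x y : X}
    (hx : x ∈ S) (hy : y ∈ S) : σ x = σ y := by
  let : TopologicalSpace α := ⊥
  have : DiscreteTopology α := ⟨rfl⟩
  refine hS.constant (fun z hz ↦ ContinuousAt.continuousWithinAt ?_) hx hy
  rw [ContinuousAt, nhds_discrete α, tendsto_pure]
  exact h z hz

end Variational

section SignConstancy

variable {E : Type*} [NormedAddCommGroup E] [NormedSpace ℝ E]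

theorem HasFDerivAt.exists_pos_mul_norm_sub_le {f : E → E} {T : E →L[ℝ] E} {x : E}
    (hf : HasFDerivAt f T x) (hT : ∃ c > 0, ∀ v, c * ‖v‖ ≤ ‖T v‖) :
    ∃ c > 0, ∃ r > 0, ∀ y, ‖y - x‖ < r → c * ‖y - x‖ ≤ ‖f y - f x‖ := by
  obtain ⟨c, hc, hle⟩ := hT
  obtain ⟨r, hr, hball⟩ := Metric.eventually_nhds_iff_ball.mp (hf.isLittleO.def (half_pos hc))
  refine ⟨c / 2, half_pos hc, r, hr, fun y hy ↦ ?_⟩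
  have h1 := hball y (mem_ball_iff_norm.mpr hy)
  have h2 := norm_sub_norm_le (T (y - x)) (T (y - x) - (f y - f x))
  rw [sub_sub_cancel, norm_sub_rev (T (y - x))] at h2
  linarith [hle (y - x)]

/-- On a nonempty relatively closed subset `Z` of `M`, an injectively differentiable map expands
distances uniformly on some relatively open piece. -/
theorem exists_uniform_expansion [CompleteSpace E] {M Z : Set E} (hM : IsOpen M) {f : E → E}
    {f' : E → E →L[ℝ] E} (hf : ∀ x ∈ M, HasFDerivAt f (f' x) x)
    (hf' : ∀ x ∈ M, ∃ c > 0, ∀ v, c * ‖v‖ ≤ ‖f' x v‖) (hZM : Z ⊆ M) (hne : Z.Nonempty) :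
    ∃ x ∈ Z, ∃ ε > 0, ∃ a > 0, Metric.ball x ε ⊆ M ∧ ∀ z ∈ Z ∩ Metric.ball x ε, ∀ y ∈ M,
      ‖y - z‖ < a → a * ‖y - z‖ ≤ ‖f y - f z‖ := by
  obtain ⟨z₀, hz₀⟩ := hne
  obtain ⟨r, hr, hrM⟩ := Metric.nhds_basis_closedBall.mem_iff.mp (hM.mem_nhds (hZM hz₀))
  set X := closure (Z ∩ Metric.ball z₀ r) with hX
  have hXM : X ⊆ M := (closure_mono inter_subset_right).trans
    (Metric.closure_ball_subset_closedBall.trans hrM)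
  let A (n : ℕ) : Set E := {x | ∀ y ∈ M, ‖y - x‖ < 1 / (n + 1 : ℝ) →
    1 / (n + 1 : ℝ) * ‖y - x‖ ≤ ‖f y - f x‖}
  have hA (n : ℕ) : IsClosed (X ∩ A n) := by
    refine isClosed_of_closure_subset fun x hx ↦ ?_
    have hxX : x ∈ X := closure_minimal inter_subset_left isClosed_closure hx
    refine ⟨hxX, fun y hy hyx ↦ ?_⟩
    obtain ⟨u, hu, hux⟩ := mem_closure_iff_seq_limit.mp hx
    have h1 : Tendsto (fun k ↦ ‖y - u k‖) atTop (𝓝 ‖y - x‖) := (hux.const_sub y).norm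
    have h2 : Tendsto (fun k ↦ ‖f y - f (u k)‖) atTop (𝓝 ‖f y - f x‖) :=
      (((hf x (hXM hxX)).continuousAt.tendsto.comp hux).const_sub (f y)).norm
    refine le_of_tendsto_of_tendsto (h1.const_mul _) h2 ?_
    filter_upwards [h1.eventually (Iio_mem_nhds hyx)] with k hk using (hu k).2 y hy hk
  have hcover : X ⊆ ⋃ n, A n := by
    intro x hx
    obtain ⟨c, hc, ρ, hρ, hle⟩ := (hf x (hXM hx)).exists_pos_mul_norm_sub_le (hf' x (hXM hx))
    obtain ⟨n, hn⟩ := exists_nat_one_div_lt (lt_min hc hρ)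
    refine mem_iUnion.mpr ⟨n, fun y _ hyx ↦ ?_⟩
    refine le_trans ?_ (hle y (hyx.trans (hn.trans_le (min_le_right _ _))))
    gcongr
    exact hn.le.trans (min_le_left _ _)
  have hXne : X.Nonempty := ⟨z₀, subset_closure ⟨hz₀, Metric.mem_ball_self hr⟩⟩
  obtain ⟨n, x, hx, ε, hε, hsub⟩ :=
    isClosed_closure.exists_inter_ball_subset_of_subset_iUnion hXne hA hcover
  obtain ⟨z, hzx, hzZ, hzr⟩ := mem_closure_iff.mp hx _ Metric.isOpen_ball (Metric.mem_ball_self hε)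
  obtain ⟨ε', hε', hball⟩ := Metric.isOpen_iff.mp
    ((Metric.isOpen_ball (x := x) (ε := ε)).inter (Metric.isOpen_ball (x := z₀) (ε := r)))
    z ⟨hzx, hzr⟩
  refine ⟨z, hzZ, ε', hε', 1 / (n + 1 : ℝ), by positivity, fun y hy ↦
    hrM (Metric.ball_subset_closedBall (hball hy).2), fun u hu ↦ ?_⟩
  exact hsub ⟨subset_closure ⟨hu.1, (hball hu.2).2⟩, (hball hu.2).1⟩

/-- Near a point `z` where `f` is injectively differentiable, the image of the segment between two
preimages of a point close to `f z` stays close to that point. -/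
theorem HasFDerivAt.exists_norm_sub_le_of_segment {f : E → E} {T : E →L[ℝ] E} {z : E}
    (hf : HasFDerivAt f T z) (hT : ∃ c > 0, ∀ v, c * ‖v‖ ≤ ‖T v‖) {L η : ℝ} (hL : 0 < L)
    (hη : 0 < η) : ∃ t₀ > 0, ∀ t > 0, t ≤ t₀ → ∀ x₁ x₂, f x₁ = f x₂ → ‖x₁ - z‖ ≤ L * t →
      ‖x₂ - z‖ ≤ L * t → ∀ u ∈ segment ℝ x₁ x₂, ‖f u - f x₁‖ ≤ η * t := by
  obtain ⟨c, hc, hle⟩ := hT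
  set θ := η / (2 * L * (‖T‖ / c + 1)) with hθ
  have hθ0 : 0 < θ := by positivity
  obtain ⟨r, hr, hball⟩ := Metric.nhds_basis_closedBall.mem_iff.mp (hf.isLittleO.def hθ0)
  refine ⟨r / L, by positivity, fun t ht htr x₁ x₂ h12 h1 h2 u hu ↦ ?_⟩
  have hLt : L * t ≤ r := by rw [le_div_iff₀ hL] at htr; linarith
  have hlin : ∀ v, ‖v - z‖ ≤ L * t → ‖f v - f z - T (v - z)‖ ≤ θ * (L * t) := by
    intro v hv
    have h3 : ‖f v - f z - T (v - z)‖ ≤ θ * ‖v - z‖ :=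
      hball (mem_closedBall_iff_norm.mpr (hv.trans hLt))
    exact h3.trans (by gcongr)
  have hu' : ‖u - z‖ ≤ L * t := by
    have := (convex_closedBall z (L * t)).segment_subset (mem_closedBall_iff_norm.mpr h1)
      (mem_closedBall_iff_norm.mpr h2) hu
    exact mem_closedBall_iff_norm.mp this
  have hdiff : ∀ v, ‖v - z‖ ≤ L * t → ‖f v - f x₁ - T (v - x₁)‖ ≤ 2 * (θ * (L * t)) := by
    intro v hv
    have e : f v - f x₁ - T (v - x₁) = (f v - f z - T (v - z)) - (f x₁ - f z - T (x₁ - z)) := by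
      simp only [map_sub]; abel
    rw [e]
    linarith [norm_sub_le (f v - f z - T (v - z)) (f x₁ - f z - T (x₁ - z)), hlin v hv, hlin x₁ h1]
  have h21 : ‖x₂ - x₁‖ ≤ 2 * (θ * (L * t)) / c := by
    have h3 := hdiff x₂ h2
    rw [h12, sub_self, zero_sub, norm_neg] at h3
    rw [le_div_iff₀ hc]
    linarith [hle (x₂ - x₁)]
  have hux : ‖u - x₁‖ ≤ ‖x₂ - x₁‖ := by
    obtain ⟨s, hs, rfl⟩ := (segment_eq_image' ℝ x₁ x₂ ▸ hu : u ∈ _ '' _)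
    rw [add_sub_cancel_left, norm_smul, Real.norm_of_nonneg hs.1]
    exact mul_le_of_le_one_left (norm_nonneg _) hs.2
  have h3 : ‖f u - f x₁‖ ≤ ‖f u - f x₁ - T (u - x₁)‖ + ‖T (u - x₁)‖ := by
    simpa using norm_add_le (f u - f x₁ - T (u - x₁)) (T (u - x₁))
  have h4 : ‖T (u - x₁)‖ ≤ ‖T‖ * (2 * (θ * (L * t)) / c) :=
    (T.le_opNorm _).trans (by gcongr; exact hux.trans h21)
  have h5 : 2 * (θ * (L * t)) + ‖T‖ * (2 * (θ * (L * t)) / c) = η * t := by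
    rw [hθ]; field_simp; ring
  linarith [hdiff u hu']

omit [NormedSpace ℝ E] in
/-- Suppose that a function `σ` is locally constant at every preimage in the ball `B` of a point of
the set `D`, that some point of `D` has a preimage with the value `b`, and that preimages can be
lifted to nearby points preserving `σ`. Then every point of `D` has a preimage with value `b`. -/
theorem IsPreconnected.subset_image_of_lift {α : Type*} {D B M : Set E} (hD : IsPreconnected D)
    (hDo : IsOpen D) {f : E → E} {σ : E → α} (hBM : B ⊆ M) (hB : IsClosed B)
    (hclosed : ∀ S ⊆ M, IsClosed S → IsClosed (f '' S))
    (hσ : ∀ x ∈ M, ∀ r > 0, ∃ δ > 0, ∀ y, ‖y - f x‖ < δ →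
      ∃ u ∈ Metric.ball x r, u ∈ M ∧ f u = y ∧ σ u = σ x)
    (hinterior : ∀ x ∈ B, f x ∈ D → x ∈ interior B)
    (hloc : ∀ x ∈ B, f x ∈ D → ∀ᶠ u in 𝓝 x, σ u = σ x) {b : α}
    (hne : ∃ x ∈ B, f x ∈ D ∧ σ x = b) : ∀ y ∈ D, ∃ x ∈ B, f x = y ∧ σ x = b := by
  set Q : Set E := {y | y ∈ D ∧ ∃ x ∈ B, f x = y ∧ σ x = b} with hQ
  have hQo : IsOpen Q := by
    rw [isOpen_iff_mem_nhds]
    rintro _ ⟨hyD, x, hxB, rfl, hxb⟩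
    obtain ⟨r, hr, hrB⟩ := Metric.mem_nhds_iff.mp
      (mem_interior_iff_mem_nhds.mp (hinterior x hxB hyD))
    obtain ⟨δ, hδ, hlift⟩ := hσ x (hBM hxB) r hr
    filter_upwards [hDo.mem_nhds hyD, Metric.ball_mem_nhds _ hδ] with y hy hyδ
    obtain ⟨u, hur, -, hfu, hσu⟩ := hlift y (mem_ball_iff_norm.mp hyδ)
    exact ⟨hy, u, hrB hur, hfu, hσu.trans hxb⟩
  set G : Set E := {x | ∀ᶠ u in 𝓝 x, σ u ≠ b}
  have hGo : IsOpen G := isOpen_iff_mem_nhds.mpr fun x hx ↦ eventually_eventually_nhds.mpr hx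
  have hcl : IsClosed (f '' (B \ G)) := hclosed _ (sdiff_subset.trans hBM) (hB.sdiff hGo)
  have hQsub : Q ⊆ f '' (B \ G) := by
    rintro _ ⟨hyD, x, hxB, rfl, hxb⟩
    exact ⟨x, ⟨hxB, fun hG ↦ hG.self_of_nhds hxb⟩, rfl⟩
  have hsub : D ⊆ Q := by
    refine hD.subset_of_closure_inter_subset hQo ?_ ?_
    · obtain ⟨x, hxB, hxD, hxb⟩ := hne
      exact ⟨f x, hxD, hxD, x, hxB, rfl, hxb⟩
    · rintro y ⟨hyQ, hyD⟩
      obtain ⟨x, ⟨hxB, hxG⟩, rfl⟩ := closure_minimal hQsub hcl hyQ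
      refine ⟨hyD, x, hxB, rfl, ?_⟩
      by_contra hxb
      exact hxG ((hloc x hxB hyD).mono fun u hu ↦ hu ▸ hxb)
  exact fun y hy ↦ (hsub hy).2

/-- Let `f` be injectively differentiable with closed image map on an open convex set `M`. A
function `σ` on `M` such that preimages can be lifted to nearby points preserving `σ`
is constant. -/
theorem Convex.eq_of_lift [CompleteSpace E] {α : Type*} {M : Set E} (hconv : Convex ℝ M)
    (hM : IsOpen M) {f : E → E} {f' : E → E →L[ℝ] E} {σ : E → α}
    (hf : ∀ x ∈ M, HasFDerivAt f (f' x) x)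
    (hf' : ∀ x ∈ M, ∃ c > 0, ∀ v, c * ‖v‖ ≤ ‖f' x v‖)
    (hclosed : ∀ S ⊆ M, IsClosed S → IsClosed (f '' S))
    (hσ : ∀ x ∈ M, ∀ r > 0, ∃ δ > 0, ∀ y, ‖y - f x‖ < δ →
      ∃ u ∈ Metric.ball x r, u ∈ M ∧ f u = y ∧ σ u = σ x) :
    ∀ x ∈ M, ∀ y ∈ M, σ x = σ y := by
  set Z : Set E := {x | x ∈ M ∧ ¬∀ᶠ u in 𝓝 x, σ u = σ x} with hZ
  rcases Z.eq_empty_or_nonempty with hempty | hZne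
  · refine fun x hx y hy ↦ hconv.isPreconnected.eq_of_eventually_eq (fun u hu ↦ ?_) hx hy
    by_contra hcon
    exact (hempty ▸ (⟨hu, hcon⟩ : u ∈ Z) : u ∈ (∅ : Set E))
  exfalso
  obtain ⟨p, hpZ, ε, hε, a, ha, hεM, hexp⟩ :=
    exists_uniform_expansion hM hf hf' (fun x hx ↦ hx.1) hZne
  obtain ⟨r, hr, hrm⟩ := exists_between (lt_min hε (half_pos ha))
  have hrε := hrm.trans_le (min_le_left _ _)
  have hra := hrm.trans_le (min_le_right _ _)
  set C := Metric.closedBall p r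
  have hCε : C ⊆ Metric.ball p ε := Metric.closedBall_subset_ball hrε
  have hCM : C ⊆ M := hCε.trans hεM
  have hexpC : ∀ z ∈ Z ∩ C, ∀ u ∈ C, a * ‖u - z‖ ≤ ‖f u - f z‖ := by
    refine fun z hz u hu ↦ hexp z ⟨hz.1, hCε hz.2⟩ u (hCM hu) ?_
    rw [← dist_eq_norm]
    linarith [dist_triangle_right u z p, Metric.mem_closedBall.mp hu, Metric.mem_closedBall.mp hz.2]
  have hS : IsClosed (f '' (Z ∩ C)) := by
    refine hclosed _ (inter_subset_right.trans hCM) ?_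
    have hGo : IsOpen {x | ∀ᶠ u in 𝓝 x, σ u = σ x} := isOpen_iff_mem_nhds.mpr fun x hx ↦ by
      have hx' : ∀ᶠ u in 𝓝 x, σ u = σ x := hx
      filter_upwards [eventually_eventually_nhds.mpr hx'] with u hu
      exact hu.mono fun v hv ↦ hv.trans hu.self_of_nhds.symm
    convert (Metric.isClosed_closedBall (x := p) (ε := r)).sdiff hGo using 1
    ext x
    exact ⟨fun hx ↦ ⟨hx.2, hx.1.2⟩, fun hx ↦ ⟨⟨hCM hx.1, hx.2⟩, hx.1⟩⟩
  have hpC : p ∈ Z ∩ C := ⟨hpZ, Metric.mem_closedBall_self hr.le⟩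
  obtain ⟨δ, hδ, hδr, hlift⟩ : ∃ δ > 0, δ ≤ a * r ∧ ∀ y, ‖y - f p‖ < δ →
      ∃ u ∈ C, f u = y ∧ σ u = σ p := by
    obtain ⟨δ, hδ, hlift⟩ := hσ p hpZ.1 r hr
    refine ⟨min δ (a * r), lt_min hδ (by positivity), min_le_right _ _, fun y hy ↦ ?_⟩
    obtain ⟨u, hu, -, hfu⟩ := hlift y (hy.trans_le (min_le_left _ _))
    exact ⟨u, Metric.ball_subset_closedBall hu, hfu⟩
  obtain ⟨x, hσx, hxr, hxδ⟩ : ∃ x, σ x ≠ σ p ∧ x ∈ C ∧ dist (f p) (f x) < δ / 2 := by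
    have hC : ∀ᶠ u in 𝓝 p, u ∈ C := Metric.closedBall_mem_nhds p hr
    have h1 : ∀ᶠ u in 𝓝 p, dist (f p) (f u) < δ / 2 :=
      ((hf p hpZ.1).continuousAt.eventually (Metric.ball_mem_nhds _ (half_pos hδ))).mono
        fun u hu ↦ Metric.mem_ball'.mp hu
    exact ((Filter.not_eventually.mp hpZ.2).and_eventually (hC.and h1)).exists
  by_cases hxS : f x ∈ f '' (Z ∩ C)
  · obtain ⟨z, hz, hzx⟩ := hxS
    obtain ⟨u, hu, hfu, hσu⟩ := hlift (f x) (by rw [← dist_eq_norm, dist_comm]; linarith)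
    have huniq : ∀ v ∈ C, f v = f x → v = z := by
      intro v hv hvx
      have h1 := hexpC z hz v hv
      rw [hvx, hzx, sub_self, norm_zero] at h1
      have h2 : ‖v - z‖ ≤ 0 := by nlinarith [norm_nonneg (v - z)]
      exact sub_eq_zero.mp (norm_le_zero_iff.mp h2)
    exact hσx (by rw [huniq x hxr rfl, ← huniq u hu hfu, hσu])
  obtain ⟨_, ⟨z, hz, rfl⟩, hdz, hmin⟩ :=
    hS.exists_ekeland_dist (mem_image_of_mem f hpC) (f x) (one_half_pos (α := ℝ))
  set d := dist (f z) (f x) with hd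
  have hd0 : 0 < d := dist_pos.mpr fun h ↦ hxS (h ▸ mem_image_of_mem f hz)
  set D : Set E := {y | dist y (f x) + 1 / 2 * dist y (f z) < d} with hD
  have hDδ : ∀ y ∈ D, ‖y - f p‖ < δ := by
    intro y hy
    have h1 : dist y (f x) + 1 / 2 * dist y (f z) < d := hy
    rw [← dist_eq_norm]
    linarith [dist_triangle_right y (f p) (f x), dist_nonneg (x := y) (y := f z)]
  have hDloc : ∀ u ∈ C, f u ∈ D → ∀ᶠ v in 𝓝 u, σ v = σ u := by
    intro u hu huD
    by_contra hcon
    have h1 : dist (f u) (f x) + 1 / 2 * dist (f u) (f z) < d := huD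
    exact h1.not_ge (hmin _ (mem_image_of_mem f ⟨⟨hCM hu, hcon⟩, hu⟩))
  have hDint : ∀ u ∈ C, f u ∈ D → u ∈ interior C := by
    intro u hu huD
    refine Metric.ball_subset_interior_closedBall (mem_ball_iff_norm.mpr ?_)
    have h1 := (hexpC p hpC u hu).trans_lt ((hDδ _ huD).trans_le hδr)
    exact lt_of_mul_lt_mul_left h1 ha.le
  have hDo : IsOpen D := isOpen_lt (by fun_prop) continuous_const
  have hDc : Convex ℝ D := by
    have h1 := ((convexOn_univ_dist (f x)).add
      ((convexOn_univ_dist (f z)).smul (one_half_pos (α := ℝ)).le)).convex_lt d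
    simpa [hD] using h1
  have hxD : f x ∈ D := by
    have h1 : dist (f x) (f x) + 1 / 2 * dist (f x) (f z) < d := by
      rw [dist_self, dist_comm]; linarith
    exact h1
  have hopp := hDc.isPreconnected.subset_image_of_lift hDo hCM Metric.isClosed_closedBall hclosed
    hσ hDint hDloc ⟨x, hxr, hxD, rfl⟩
  obtain ⟨t₀, ht₀, hseg⟩ := (hf z (hCM hz.2)).exists_norm_sub_le_of_segment (hf' z (hCM hz.2))
    (div_pos hd0 ha) (div_pos hd0 (by norm_num : (0 : ℝ) < 4))
  obtain ⟨t, ht, htt₀, ht1⟩ : ∃ t > 0, t ≤ t₀ ∧ t ≤ 1 :=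
    ⟨min t₀ 1, lt_min ht₀ one_pos, min_le_left _ _, min_le_right _ _⟩
  set w := f z + t • (f x - f z) with hw
  have hwz : dist w (f z) = t * d := by
    rw [hw, dist_eq_norm, add_sub_cancel_left, norm_smul, Real.norm_of_nonneg ht.le, hd, dist_comm,
      dist_eq_norm]
  have hwx : dist w (f x) = (1 - t) * d := by
    have e : w - f x = (1 - t) • (f z - f x) := by rw [hw]; module
    rw [dist_eq_norm, e, norm_smul, Real.norm_of_nonneg (sub_nonneg.mpr ht1), hd, dist_eq_norm]
  have htd : 0 < t * d := mul_pos ht hd0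
  have hnear : ∀ y, dist y w ≤ t * d / 4 → y ∈ D := by
    intro y hy
    have h1 : dist y (f x) + 1 / 2 * dist y (f z) < d := by
      linarith [dist_triangle y w (f x), dist_triangle y w (f z)]
    exact h1
  have hwD : w ∈ D := hnear w (by rw [dist_self]; positivity)
  obtain ⟨u₁, hu₁, hfu₁, hσu₁⟩ := hlift w (hDδ w hwD)
  obtain ⟨u₂, hu₂, hfu₂, hσu₂⟩ := hopp w hwD
  have hclose : ∀ u ∈ C, f u = w → ‖u - z‖ ≤ d / a * t := by
    intro u hu huw
    have h1 := hexpC z hz u hu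
    rw [huw, ← dist_eq_norm w, hwz] at h1
    rw [div_mul_eq_mul_div, le_div_iff₀ ha]
    linarith
  have hsegD : ∀ u ∈ segment ℝ u₁ u₂, ∀ᶠ v in 𝓝 u, σ v = σ u := by
    intro u hu
    refine hDloc u ((convex_closedBall p r).segment_subset hu₁ hu₂ hu) (hnear _ ?_)
    have h1 := hseg t ht htt₀ u₁ u₂ (hfu₁.trans hfu₂.symm) (hclose u₁ hu₁ hfu₁)
      (hclose u₂ hu₂ hfu₂) u hu
    rw [hfu₁] at h1
    rw [dist_eq_norm]
    linarith
  refine hσx ?_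
  rw [← hσu₂, ← hσu₁]
  exact (convex_segment u₁ u₂).isPreconnected.eq_of_eventually_eq hsegD
    (right_mem_segment ℝ u₁ u₂) (left_mem_segment ℝ u₁ u₂)

end SignConstancy

section FixedPoint

theorem IsCompactMapOn.isClosed_image_sub {E : Type*} [NormedAddCommGroup E] {F : E → E}
    {S T : Set E} (h : IsCompactMapOn F T) (hST : S ⊆ T) (hS : IsClosed S) :
    IsClosed ((fun x ↦ x - F x) '' S) := by
  obtain ⟨hF, K, hK, hFK⟩ := h
  refine isClosed_of_closure_subset fun y hy ↦ ?_
  obtain ⟨v, hv, hvy⟩ := mem_closure_iff_seq_limit.mp hy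
  choose u huS huv using hv
  obtain ⟨k, -, φ, hφ, hk⟩ := hK.tendsto_subseq fun n ↦ hFK (hST (huS n))
  have hu : Tendsto (u ∘ φ) atTop (𝓝 (y + k)) := by
    refine ((hvy.comp hφ.tendsto_atTop).add hk).congr fun n ↦ ?_
    simp [← huv]
  have hmem : y + k ∈ S := hS.mem_of_tendsto hu (Eventually.of_forall fun n ↦ huS _)
  have hFu : Tendsto (fun n ↦ F (u (φ n))) atTop (𝓝 (F (y + k))) :=
    (hF _ (hST hmem)).tendsto.comp (tendsto_nhdsWithin_iff.mpr
      ⟨hu, Eventually.of_forall fun n ↦ hST (huS _)⟩)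
  refine ⟨y + k, hmem, ?_⟩
  change y + k - F (y + k) = y
  rw [tendsto_nhds_unique hFu hk, add_sub_cancel_right]

theorem IsCompactRegularOn.localSign_eq_localSign {E : Type*} [NormedAddCommGroup E]
    [NormedSpace ℝ E] [CompleteSpace E] {F : E → E}
    {F' : E → E →L[ℝ] E} {M : Set E} (h : IsCompactRegularOn F F' M) (hconv : Convex ℝ M)
    {x y : E} (hx : x ∈ M) (hy : y ∈ M) : localSign (F' x) x = localSign (F' y) y := by
  exact hconv.eq_of_lift h.isOpen (f := fun x ↦ x - F x)
    (f' := fun x ↦ ContinuousLinearMap.id ℝ E - F' x) (σ := fun x ↦ localSign (F' x) x)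
    (fun u hu ↦ (hasFDerivAt_id u).sub (h.hasFDerivAt u hu))
    (fun u hu ↦ (h.isCompactOperator hu).exists_pos_le_norm_sub (h.apply_ne u hu))
    (fun S hS hSc ↦ h.isCompactMapOn.isClosed_image_sub (hS.trans subset_closure) hSc)
    (fun u hu r hr ↦ h.exists_preimage_localSign_eq hu hr) x hx y hy

end FixedPoint

/-- Kellogg's uniqueness theorem for fixed points: if `M` is a nonempty bounded convex
open subset of a real Banach space `E`, `F` maps `closure M` into itself continuously
with relatively compact image, `F` is Fréchet differentiable at every point of `M`,
`1` is never an eigenvalue of `F'(m)` for `m ∈ M`, and `F` has no fixed point on the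
boundary of `M`, then `F` has a unique fixed point, which lies in `M`. -/
theorem kellogg_unique_fixed_point
    {E : Type*} [NormedAddCommGroup E] [NormedSpace ℝ E] [CompleteSpace E]
    (M : Set E) (hne : M.Nonempty) (hbdd : Bornology.IsBounded M)
    (hconv : Convex ℝ M) (hopen : IsOpen M)
    (F : E → E) (F' : E → E →L[ℝ] E)
    (hmaps : Set.MapsTo F (closure M) (closure M))
    (hcont : ContinuousOn F (closure M))
    (hcpt : IsCompact (closure (F '' closure M)))
    (hdiff : ∀ m ∈ M, HasFDerivAt F (F' m) m)
    (heig : ∀ m ∈ M, ∀ v : E, v ≠ 0 → F' m v ≠ v)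
    (hbdry : ∀ m ∈ frontier M, F m ≠ m) :
    ∃ x ∈ M, F x = x ∧ ∀ y ∈ closure M, F y = y → y = x := by
  have h : IsCompactRegularOn F F' M :=
    ⟨hopen, ⟨hcont, _, hcpt, fun x hx ↦ subset_closure (Set.mem_image_of_mem F hx)⟩, hdiff, heig⟩
  obtain ⟨t, ht, hsum⟩ := h.exists_sum_localSign_eq_one hne hbdd hconv hmaps hbdry
  obtain ⟨m, hm⟩ := hne
  have hcard : (t.card : ℝ) * localSign (F' m) m = 1 := by
    rw [← hsum, ← nsmul_eq_mul, ← Finset.sum_const]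
    exact Finset.sum_congr rfl fun x hx ↦ h.localSign_eq_localSign hconv hm ((ht x).mp hx).1
  have hcard1 : t.card = 1 := by
    rcases localSign_eq (F' m) m with h1 | h1 <;> rw [h1] at hcard
    · exact_mod_cast (mul_one (t.card : ℝ)).symm.trans hcard
    · linarith [Nat.cast_nonneg (α := ℝ) t.card]
  obtain ⟨x, rfl⟩ := Finset.card_eq_one.mp hcard1
  obtain ⟨hxM, hFx⟩ := (ht x).mp (Finset.mem_singleton_self x)
  refine ⟨x, hxM, hFx, fun y hy hFy ↦ ?_⟩
  have hyM : y ∈ M := by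
    by_contra hyM
    exact hbdry y (hopen.frontier_eq ▸ ⟨hy, hyM⟩) hFy
  exact Finset.mem_singleton.mp ((ht y).mpr ⟨hyM, hFy⟩)
end

section
/- Let d ≥ 2, let S = S^{d−1} be the unit sphere in ℝ^d with surface measure σ and total mass ν = σ(S). Let 0 < θ̲ ≤ θ̄ and let p : S × S → ℝ be measurable with θ̲ ≤ p(k, k') ≤ θ̄ for all k, k' ∈ S; define Kg(k) = ∫_S p(k, k') g(k') dσ(k'). Let v : S → ℝ be integrable with ∫_S v dσ = 0 and let w : S → ℝ be integrable with w(k) > 0 for all k ∈ S. Set κ = (θ̄ − θ̲)/(2 sqrt(θ̲)). Then ∫_S (Kv)(k)² / (Kw)(k) dσ(k) ≤ ν · κ² · ∫_S v(k)²/w(k) dσ(k). -/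
open MeasureTheory

/-- The surface measure on the unit sphere `S^{d-1} ⊆ ℝ^d`. -/
noncomputable def sphereSurfaceMeasure (d : ℕ) :
    Measure (Metric.sphere (0 : EuclideanSpace ℝ (Fin d)) 1) :=
  (volume : Measure (EuclideanSpace ℝ (Fin d))).toSphere

section ScatteringBound

variable {α : Type*} [MeasurableSpace α] {μ : Measure α}

theorem sq_integral_abs_div_integral_le {v w : α → ℝ} (hv : Integrable v μ) (hw : Integrable w μ)
    (hwpos : ∀ x, 0 < w x) (hW : 0 < ∫ x, w x ∂μ) :
    ENNReal.ofReal ((∫ x, |v x| ∂μ) ^ 2 / ∫ x, w x ∂μ) ≤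
      ∫⁻ x, ENNReal.ofReal (v x ^ 2 / w x) ∂μ := by
  have hnn : ∀ x, 0 ≤ v x ^ 2 / w x := fun x => div_nonneg (sq_nonneg _) (hwpos x).le
  have hmeas : AEStronglyMeasurable (fun x => v x ^ 2 / w x) μ :=
    ((hv.aemeasurable.pow_const 2).div hw.aemeasurable).aestronglyMeasurable
  by_cases htop : ∫⁻ x, ENNReal.ofReal (v x ^ 2 / w x) ∂μ = ⊤
  · simp [htop]
  have hint : Integrable (fun x => v x ^ 2 / w x) μ :=
    (lintegral_ofReal_ne_top_iff_integrable hmeas (.of_forall hnn)).mp htop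
  rw [← ofReal_integral_eq_lintegral_ofReal hint (.of_forall hnn)]
  apply ENNReal.ofReal_le_ofReal
  set W := ∫ x, w x ∂μ
  set A := ∫ x, |v x| ∂μ
  have hpt : ∀ x, 2 * (A / W) * |v x| ≤ (A / W) ^ 2 * w x + v x ^ 2 / w x := by
    intro x
    have hx := hwpos x
    have : (A / W) ^ 2 * w x + v x ^ 2 / w x - 2 * (A / W) * |v x| =
        (A / W * w x - |v x|) ^ 2 / w x := by
      rw [← sq_abs (v x)]
      field_simp
      ring
    have h2 : 0 ≤ (A / W * w x - |v x|) ^ 2 / w x := by positivity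
    linarith
  have key := integral_mono (hv.abs.const_mul (2 * (A / W)))
    ((hw.const_mul ((A / W) ^ 2)).add hint) hpt
  simp only [Pi.add_apply] at key
  rw [integral_add (hw.const_mul _) hint, integral_const_mul, integral_const_mul] at key
  change 2 * (A / W) * A ≤ (A / W) ^ 2 * W + _ at key
  have e1 : 2 * (A / W) * A = 2 * (A ^ 2 / W) := by ring
  have e2 : (A / W) ^ 2 * W = A ^ 2 / W := by field_simp
  linarith

theorem integrable_kernel_mul {q g : α → ℝ} {a b : ℝ} (hq : Measurable q)
    (hlo : ∀ x, a ≤ q x) (hhi : ∀ x, q x ≤ b) (hg : Integrable g μ) :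
    Integrable (fun x => q x * g x) μ :=
  hg.bdd_mul hq.aestronglyMeasurable (c := max |a| |b|)
    (.of_forall fun x => abs_le_max_abs_abs (hlo x) (hhi x))

theorem abs_integral_kernel_mul_le {q v : α → ℝ} {a b : ℝ} (hq : Measurable q)
    (hlo : ∀ x, a ≤ q x) (hhi : ∀ x, q x ≤ b) (hv : Integrable v μ)
    (hmean : ∫ x, v x ∂μ = 0) :
    |∫ x, q x * v x ∂μ| ≤ (b - a) / 2 * ∫ x, |v x| ∂μ := by
  have hqv := integrable_kernel_mul hq hlo hhi hv
  have hcenter : ∫ x, q x * v x ∂μ = ∫ x, (q x * v x - (a + b) / 2 * v x) ∂μ := by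
    rw [integral_sub hqv (hv.const_mul _), integral_const_mul, hmean]
    ring
  rw [hcenter, ← integral_const_mul, ← Real.norm_eq_abs]
  refine norm_integral_le_of_norm_le (hv.abs.const_mul _) (.of_forall fun x => ?_)
  rw [← sub_mul, norm_mul, Real.norm_eq_abs, Real.norm_eq_abs]
  gcongr
  rw [abs_le]
  constructor <;> linarith [hlo x, hhi x]

theorem ofReal_sq_integral_kernel_div_le [NeZero μ] {q v w : α → ℝ} {a b : ℝ} (ha : 0 < a)
    (hq : Measurable q) (hlo : ∀ x, a ≤ q x) (hhi : ∀ x, q x ≤ b) (hv : Integrable v μ)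
    (hmean : ∫ x, v x ∂μ = 0) (hw : Integrable w μ) (hwpos : ∀ x, 0 < w x) :
    ENNReal.ofReal ((∫ x, q x * v x ∂μ) ^ 2 / ∫ x, q x * w x ∂μ) ≤
      ENNReal.ofReal (((b - a) / (2 * √a)) ^ 2) * ∫⁻ x, ENNReal.ofReal (v x ^ 2 / w x) ∂μ := by
  have hW : 0 < ∫ x, w x ∂μ := by
    rw [integral_pos_iff_support_of_nonneg (fun x => (hwpos x).le) hw,
      Function.support_eq_univ fun x => (hwpos x).ne']
    exact NeZero.pos _
  have hKw : a * ∫ x, w x ∂μ ≤ ∫ x, q x * w x ∂μ := by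
    rw [← integral_const_mul]
    exact integral_mono (hw.const_mul a) (integrable_kernel_mul hq hlo hhi hw)
      fun x => mul_le_mul_of_nonneg_right (hlo x) (hwpos x).le
  have hKv : (∫ x, q x * v x ∂μ) ^ 2 ≤ ((b - a) / 2 * ∫ x, |v x| ∂μ) ^ 2 :=
    sq_le_sq.mpr ((abs_integral_kernel_mul_le hq hlo hhi hv hmean).trans (le_abs_self _))
  calc ENNReal.ofReal ((∫ x, q x * v x ∂μ) ^ 2 / ∫ x, q x * w x ∂μ)
      ≤ ENNReal.ofReal (((b - a) / (2 * √a)) ^ 2 * ((∫ x, |v x| ∂μ) ^ 2 / ∫ x, w x ∂μ)) := by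
        refine ENNReal.ofReal_le_ofReal ((div_le_div₀ (sq_nonneg _) hKv (by positivity)
          hKw).trans_eq ?_)
        rw [div_pow, mul_pow 2, Real.sq_sqrt ha.le]
        field_simp
    _ = ENNReal.ofReal (((b - a) / (2 * √a)) ^ 2) *
          ENNReal.ofReal ((∫ x, |v x| ∂μ) ^ 2 / ∫ x, w x ∂μ) :=
        ENNReal.ofReal_mul (sq_nonneg _)
    _ ≤ _ := by
        gcongr
        exact sq_integral_abs_div_integral_le hv hw hwpos hW

end ScatteringBound

/-- For the scattering operator `Kg(k) = ∫ p(k,·) g dσ` with phase function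
`θ̲ ≤ p ≤ θ̄`, a mean-zero `v` and a positive weight `w`, one has
`∫ (Kv)²/(Kw) dσ ≤ ν κ² ∫ v²/w dσ` with `κ = (θ̄ - θ̲)/(2√θ̲)` and `ν = σ(S)`;
the integrals take values in `[0, ∞]`. -/
theorem scattering_operator_L2_bound
    (d : ℕ) (hd : 2 ≤ d) (θlo θhi : ℝ) (hθlo : 0 < θlo) (hθ : θlo ≤ θhi)
    (p : Metric.sphere (0 : EuclideanSpace ℝ (Fin d)) 1 →
         Metric.sphere (0 : EuclideanSpace ℝ (Fin d)) 1 → ℝ)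
    (hp : Measurable (Function.uncurry p))
    (hplo : ∀ k k', θlo ≤ p k k') (hphi : ∀ k k', p k k' ≤ θhi)
    (v : Metric.sphere (0 : EuclideanSpace ℝ (Fin d)) 1 → ℝ)
    (hv : Integrable v (sphereSurfaceMeasure d))
    (hmean : ∫ k, v k ∂(sphereSurfaceMeasure d) = 0)
    (w : Metric.sphere (0 : EuclideanSpace ℝ (Fin d)) 1 → ℝ)
    (hw : Integrable w (sphereSurfaceMeasure d))
    (hwpos : ∀ k, 0 < w k)
    (K : (Metric.sphere (0 : EuclideanSpace ℝ (Fin d)) 1 → ℝ) →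
         Metric.sphere (0 : EuclideanSpace ℝ (Fin d)) 1 → ℝ)
    (hK : ∀ g k, K g k = ∫ k', p k k' * g k' ∂(sphereSurfaceMeasure d))
    (κ : ℝ) (hκ : κ = (θhi - θlo) / (2 * Real.sqrt θlo)) :
    ∫⁻ k, ENNReal.ofReal ((K v k) ^ 2 / K w k) ∂(sphereSurfaceMeasure d) ≤
      (sphereSurfaceMeasure d) Set.univ * ENNReal.ofReal (κ ^ 2) *
        ∫⁻ k, ENNReal.ofReal (v k ^ 2 / w k) ∂(sphereSurfaceMeasure d) := by
  rcases eq_or_ne (sphereSurfaceMeasure d) 0 with h0 | h0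
  · simp [h0]
  have : NeZero (sphereSurfaceMeasure d) := ⟨h0⟩
  calc ∫⁻ k, ENNReal.ofReal ((K v k) ^ 2 / K w k) ∂(sphereSurfaceMeasure d)
      ≤ ∫⁻ _, ENNReal.ofReal (κ ^ 2) *
          ∫⁻ k, ENNReal.ofReal (v k ^ 2 / w k) ∂(sphereSurfaceMeasure d)
          ∂(sphereSurfaceMeasure d) := by
        refine lintegral_mono fun k => ?_
        rw [hK, hK, hκ]
        exact ofReal_sq_integral_kernel_div_le hθlo hp.of_uncurry_left (hplo k) (hphi k)
          hv hmean hw hwpos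
    _ = _ := by
        rw [lintegral_const]
        ring
end
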